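/- Assume F contains an element i with i² = −1. For z ∈ K set ι₃(z) = Φ(z), ι₁(z) = φ ∘ Φ(z) ∘ φ⁻¹ and ι₂(z) = φ² ∘ Φ(z) ∘ φ⁻². Then the F-linear map Ψ : (𝔰𝔬₃ ⊗ K) ⊕ D̄er(K) → Der(J) given by Ψ(Eⱼ ⊗ z) = ιⱼ(z) (j = 1,2,3) and Ψ(d) = (Φ*)⁻¹(d) for d ∈ D̄er(K) is an isomorphism of Lie superalgebras onto Der(J) = 𝒯(K, D̄er(K)), where the source carries the Tits bracket: D̄er(K) is a subalgebra, [d, A ⊗ z] = A ⊗ d(z), and [A ⊗ z, B ⊗ z'] = [A,B] ⊗ zz' + (1/2)·tr(AB)·D(z,z') for A, B ∈ 𝔰𝔬₃, z, z' ∈ K, d ∈ D̄er(K). Moreover Ψ restricts to an isomorphism of the subalgebra 𝒯(K) = (𝔰𝔬₃ ⊗ K) ⊕ Inder(K) onto Inder(J). -/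

import Mathlib

namespace CKJ

variable (F : Type*) [Field F] {Z : Type*} [CommRing Z] [Algebra F Z]

/-- Underlying module of the Cheng–Kac Jordan superalgebra `JCK(Z,δ)`:
the even part has `Z`-coordinates `1, w₁, w₂, w₃` (indices `0,1,2,3`) and the
odd part has `Z`-coordinates `x, x₁, x₂, x₃` (indices `0,1,2,3`). -/
abbrev J (Z : Type*) := (Fin 4 → Z) × (Fin 4 → Z)

/-- The product of two even elements, in coordinates:
`w₁² = w₂² = 1`, `w₃² = -1`, `wᵢwⱼ = 0` for `i ≠ j`. -/
def emul (a c : Fin 4 → Z) : Fin 4 → Z :=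
  ![a 0 * c 0 + a 1 * c 1 + a 2 * c 2 - a 3 * c 3,
    a 0 * c 1 + a 1 * c 0,
    a 0 * c 2 + a 2 * c 0,
    a 0 * c 3 + a 3 * c 0]

/-- The product of two odd elements: `(fx)(gx) = δ(f)g - fδ(g)`,
`(fxᵢ)(gx) = (fg)wᵢ`, `(fx)(gxⱼ) = -(fg)wⱼ`, `(fxᵢ)(gxⱼ) = 0`. -/
def omul (δ : Z → Z) (b d : Fin 4 → Z) : Fin 4 → Z :=
  ![δ (b 0) * d 0 - b 0 * δ (d 0),
    b 1 * d 0 - b 0 * d 1,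
    b 2 * d 0 - b 0 * d 2,
    b 3 * d 0 - b 0 * d 3]

/-- The product of an even element by an odd element: `f(gx) = (fg)x`,
`f(gxⱼ) = (fg)xⱼ`, `(fwᵢ)(gx) = (δ(f)g)xᵢ`, `(fwᵢ)(gxⱼ) = -(fg)x_{i×j}`. -/
def eomul (δ : Z → Z) (a d : Fin 4 → Z) : Fin 4 → Z :=
  ![a 0 * d 0,
    a 0 * d 1 + δ (a 1) * d 0 + (a 2 * d 3 - a 3 * d 2),
    a 0 * d 2 + δ (a 2) * d 0 + (a 3 * d 1 - a 1 * d 3),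
    a 0 * d 3 + δ (a 3) * d 0 + (a 2 * d 1 - a 1 * d 2)]

/-- The (supercommutative) multiplication of the Cheng–Kac Jordan
superalgebra `JCK(Z,δ)`. -/
def jmul (δ : Z → Z) (u v : J Z) : J Z :=
  (emul u.1 v.1 + omul δ u.2 v.2, eomul δ u.1 v.2 + eomul δ v.1 u.2)

/-- `fw f k` is the even element `f·wₖ` (with the convention `w₀ = 1`). -/
def fw (f : Z) (k : Fin 4) : J Z := (fun j => if j = k then f else 0, 0)

/-- `fone f` is the even element `f·1`. -/
def fone (f : Z) : J Z := fw f 0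

/-- `fxi f k` is the odd element `f·xₖ` (with the convention `x₀ = x`). -/
def fxi (f : Z) (k : Fin 4) : J Z := (0, fun j => if j = k then f else 0)

/-- `fx f` is the odd element `f·x`. -/
def fx (f : Z) : J Z := fxi f 0

/-- The grading involution of the superalgebra `J` (identity on the even part,
minus the identity on the odd part). -/
def jsig (u : J Z) : J Z := (u.1, -u.2)

/-- `F`-linearity of a map `J → J`. -/
def IsLin (d : J Z → J Z) : Prop :=
  (∀ u v, d (u + v) = d u + d v) ∧ ∀ (c : F) (u), d (c • u) = c • d u

/-- `d` is an even derivation of the superalgebra `J = JCK(Z,δ)`. -/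
def IsDer0 (δ : Z → Z) (d : J Z → J Z) : Prop :=
  IsLin F d ∧ (∀ u : J Z, u.2 = 0 → (d u).2 = 0) ∧ (∀ u : J Z, u.1 = 0 → (d u).1 = 0) ∧
    ∀ u v, d (jmul δ u v) = jmul δ (d u) v + jmul δ u (d v)

/-- `d` is an odd derivation of the superalgebra `J = JCK(Z,δ)`. -/
def IsDer1 (δ : Z → Z) (d : J Z → J Z) : Prop :=
  IsLin F d ∧ (∀ u : J Z, u.2 = 0 → (d u).1 = 0) ∧ (∀ u : J Z, u.1 = 0 → (d u).2 = 0) ∧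
    ∀ u v, d (jmul δ u v) = jmul δ (d u) v + jmul δ (jsig u) (d v)

/-- The set `Der(J) = Der(J)₀ ⊕ Der(J)₁` of all derivations of `J`. -/
def DerJSet (δ : Z → Z) : Set (J Z → J Z) :=
  {d | ∃ d0 d1, IsDer0 F δ d0 ∧ IsDer1 F δ d1 ∧ d = d0 + d1}

/-- `u` is homogeneous of parity `p` (`p = true` means odd). -/
def IsHom (p : Bool) (u : J Z) : Prop := if p then u.1 = 0 else u.2 = 0

/-- `(-1)^{pq}` -/
def sgn (p q : Bool) : ℤ := if p && q then -1 else 1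

/-- `Dgen δ ε u v` is the inner derivation `D(u,v) : c ↦ u(vc) - ε·v(uc)`;
for homogeneous `u`, `v` one takes `ε = (-1)^{|u||v|}`. -/
def Dgen (δ : Z → Z) (ε : ℤ) (u v : J Z) : J Z → J Z :=
  fun c => jmul δ u (jmul δ v c) - ε • jmul δ v (jmul δ u c)

/-- Generators `D(u,v)`, `u`, `v` homogeneous, of `Inder(J)`. -/
def InderSet (δ : Z → Z) : Set (J Z → J Z) :=
  {d | ∃ u v p q, IsHom p u ∧ IsHom q v ∧ d = Dgen δ (sgn p q) u v}

/-- Generators of the even part `Inder(J)₀`. -/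
def InderSet0 (δ : Z → Z) : Set (J Z → J Z) :=
  {d | ∃ u v p, IsHom p u ∧ IsHom p v ∧ d = Dgen δ (sgn p p) u v}

/-- Generators of the odd part `Inder(J)₁`. -/
def InderSet1 (δ : Z → Z) : Set (J Z → J Z) :=
  {d | ∃ u v p, IsHom p u ∧ IsHom (!p) v ∧ d = Dgen δ 1 u v}

/-- Coordinate index of each sector of the `ℤ₂×ℤ₂`-grading:
`[0,0] ↦ 0`, `[1,0] ↦ 1`, `[0,1] ↦ 2`, `[1,1] ↦ 3`. -/
def idx (t : ZMod 2 × ZMod 2) : Fin 4 :=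
  if t = (0, 0) then 0 else if t = (1, 0) then 1 else if t = (0, 1) then 2 else 3

/-- The sector `J^{[t]}` of the `ℤ₂×ℤ₂`-grading of `J`:
`J^{[0,0]} = Z ⊕ Zx`, `J^{[1,0]} = Zw₁ ⊕ Zx₁`, `J^{[0,1]} = Zw₂ ⊕ Zx₂`,
`J^{[1,1]} = Zw₃ ⊕ Zx₃`. -/
def gset (t : ZMod 2 × ZMod 2) : Set (J Z) :=
  {u | ∀ k : Fin 4, k ≠ idx t → u.1 k = 0 ∧ u.2 k = 0}

/-- `d : J → J` has degree `t` with respect to the `ℤ₂×ℤ₂`-grading of `J`. -/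
def DerDeg (t : ZMod 2 × ZMod 2) (d : J Z → J Z) : Prop :=
  ∀ s u, u ∈ gset s → d u ∈ gset (s + t)

/-! The Kantor double superalgebra of vector type `K = Z ⊕ Zx`, realised
as `Z × Z`: the pair `(f, g)` represents `f + gx`. -/

/-- The multiplication of `K = Z ⊕ Zx`. -/
def kmul (δ : Z → Z) (u v : Z × Z) : Z × Z :=
  (u.1 * v.1 + (δ u.2 * v.2 - u.2 * δ v.2), u.1 * v.2 + v.1 * u.2)

/-- The grading involution of `K`. -/
def ksig (u : Z × Z) : Z × Z := (u.1, -u.2)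

/-- `F`-linearity of a map `K → K`. -/
def IsKLin (d : Z × Z → Z × Z) : Prop :=
  (∀ u v, d (u + v) = d u + d v) ∧ ∀ (c : F) (u), d (c • u) = c • d u

/-- `d` is an even derivation of `K = Z ⊕ Zx`. -/
def IsKDer0 (δ : Z → Z) (d : Z × Z → Z × Z) : Prop :=
  IsKLin F d ∧ (∀ u : Z × Z, u.2 = 0 → (d u).2 = 0) ∧ (∀ u : Z × Z, u.1 = 0 → (d u).1 = 0) ∧
    ∀ u v, d (kmul δ u v) = kmul δ (d u) v + kmul δ u (d v)

/-- `d` is an odd derivation of `K = Z ⊕ Zx`. -/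
def IsKDer1 (δ : Z → Z) (d : Z × Z → Z × Z) : Prop :=
  IsKLin F d ∧ (∀ u : Z × Z, u.2 = 0 → (d u).1 = 0) ∧ (∀ u : Z × Z, u.1 = 0 → (d u).2 = 0) ∧
    ∀ u v, d (kmul δ u v) = kmul δ (d u) v + kmul δ (ksig u) (d v)

/-- `Dk δ ε u v` is the inner derivation `D(u,v) : c ↦ u(vc) - ε·v(uc)` of `K`. -/
def Dk (δ : Z → Z) (ε : ℤ) (u v : Z × Z) : Z × Z → Z × Z :=
  fun c => kmul δ u (kmul δ v c) - ε • kmul δ v (kmul δ u c)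

/-- `u ∈ K` is homogeneous of parity `p`. -/
def KHom (p : Bool) (u : Z × Z) : Prop := if p then u.1 = 0 else u.2 = 0

/-- Generators `D(u,v)`, `u`, `v` homogeneous, of `Inder(K)`. -/
def InderKSet (δ : Z → Z) : Set (Z × Z → Z × Z) :=
  {d | ∃ u v p q, KHom p u ∧ KHom q v ∧ d = Dk δ (sgn p q) u v}

/-- Generators of the even part `Inder(K)₀`. -/
def InderKSet0 (δ : Z → Z) : Set (Z × Z → Z × Z) :=
  {d | ∃ u v p, KHom p u ∧ KHom p v ∧ d = Dk δ (sgn p p) u v}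

/-- Generators of the odd part `Inder(K)₁`. -/
def InderKSet1 (δ : Z → Z) : Set (Z × Z → Z × Z) :=
  {d | ∃ u v p, KHom p u ∧ KHom (!p) v ∧ d = Dk δ 1 u v}

/-- The odd derivation `η_a` of `K`: `η_a(f) = 0`, `η_a(fx) = fa`. -/
def keta (a : Z) : Z × Z → Z × Z := fun u => (a * u.2, 0)

/-- `kcheck μ a` is the even map `μ̌` of `K` with `μ̌(f) = μ(f)` and
`μ̌(gx) = (μ(g) + ag)x`. -/
def kcheck (μ : Z → Z) (a : Z) : Z × Z → Z × Z := fun u => (μ u.1, μ u.2 + a * u.2)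

/-- The odd map `(aδ)⁻` of `K` (relevant in characteristic 3):
`(aδ)⁻(f) = (aδ(f))x`, `(aδ)⁻(fx) = δ(aδ(f))`. -/
def kminus (δ : Z → Z) (a : Z) : Z × Z → Z × Z := fun u => (δ (a * δ u.2), a * δ u.1)

/-- `D̄er(K) = Der(K)₀ ⊕ {η_a : a ∈ Z}`. -/
def DerbarK (δ : Z → Z) : Set (Z × Z → Z × Z) :=
  {e | ∃ e0 a, IsKDer0 F δ e0 ∧ e = e0 + keta a}

/-- The extension `∂̃` to `J` of the even derivation `∂ = μ̌ = kcheck μ a`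
of `K`: `∂̃|_K = ∂`, `∂̃(fwᵢ) = μ(f)wᵢ`, `∂̃(fxᵢ) = (μ(f) - af)xᵢ`. -/
def jtilde (μ : Z → Z) (a : Z) : J Z → J Z :=
  fun u => (fun k => μ (u.1 k),
    fun k => if k = 0 then μ (u.2 0) + a * u.2 0 else μ (u.2 k) - a * u.2 k)

/-- The odd derivation `η̃_a` of `J`: `η̃_a(Z) = 0`, `η̃_a(x) = a`,
`η̃_a(xⱼ) = 0` (hence `η̃_a(fwᵢ) = -(af)xᵢ`). -/
def jeta (a : Z) : J Z → J Z :=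
  fun u => (fun k => if k = 0 then a * u.2 0 else 0,
            fun k => if k = 0 then 0 else -(a * u.1 k))

/-- The even component of an endomorphism of `J`. -/
def evp (X : J Z → J Z) : J Z → J Z := fun u => (2 : F)⁻¹ • (X u + jsig (X (jsig u)))

/-- The odd component of an endomorphism of `J`. -/
def odp (X : J Z → J Z) : J Z → J Z := fun u => (2 : F)⁻¹ • (X u - jsig (X (jsig u)))

/-- The supercommutator `[X,Y]` in `End_F(J)`. -/
def sbr (X Y : J Z → J Z) : J Z → J Z :=
  X ∘ Y - Y ∘ X + (2 : F) • (odp F Y ∘ odp F X)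

/-- The odd component of an endomorphism of `K`. -/
def kodp (e : Z × Z → Z × Z) : Z × Z → Z × Z :=
  fun u => (2 : F)⁻¹ • (e u - ksig (e (ksig u)))

/-- The supercommutator `[e,e']` in `End_F(K)`. -/
def ksbr (e e' : Z × Z → Z × Z) : Z × Z → Z × Z :=
  e ∘ e' - e' ∘ e + (2 : F) • (kodp F e' ∘ kodp F e)

/-- The automorphism `τ₁ = (12)(34)`: identity on `J^{[0,0]} ⊕ J^{[1,1]}`,
`-1` on `J^{[1,0]} ⊕ J^{[0,1]}`. -/
def tau1Map : J Z → J Z :=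
  fun u => (![u.1 0, -u.1 1, -u.1 2, u.1 3], ![u.2 0, -u.2 1, -u.2 2, u.2 3])

/-- The automorphism `τ₂ = (23)(41)`: identity on `J^{[0,0]} ⊕ J^{[1,0]}`,
`-1` on `J^{[0,1]} ⊕ J^{[1,1]}`. -/
def tau2Map : J Z → J Z :=
  fun u => (![u.1 0, u.1 1, -u.1 2, -u.1 3], ![u.2 0, u.2 1, -u.2 2, -u.2 3])

/-- The automorphism `φ = (123)`: the `Z`-linear map with `φ(vⱼ) = vⱼ₊₁`,
`φ(yⱼ) = yⱼ₊₁` (indices mod 3), `φ(1) = 1`, `φ(y) = y`, where `v₁ = i·w₁`,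
`v₂ = i·w₂`, `v₃ = w₃`, `y = x`, `y₁ = i·x₁`, `y₂ = i·x₂`, `y₃ = x₃`.
In the `w`/`x` coordinates: `w₁ ↦ w₂ ↦ -i·w₃`, `w₃ ↦ i·w₁`,
`x₁ ↦ x₂ ↦ -i·x₃`, `x₃ ↦ i·x₁`. -/
def phiMap (i : F) : J Z → J Z :=
  fun u => (![u.1 0, algebraMap F Z i * u.1 3, u.1 1, -(algebraMap F Z i * u.1 2)],
            ![u.2 0, algebraMap F Z i * u.2 3, u.2 1, -(algebraMap F Z i * u.2 2)])

/-- The automorphism `τ = (12)`: `Z`-linear with `τ(1) = 1`, `τ(y) = y`,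
`τ(v₁) = -v₂`, `τ(v₂) = -v₁`, `τ(v₃) = -v₃`, `τ(y₁) = -y₂`, `τ(y₂) = -y₁`,
`τ(y₃) = -y₃`. -/
def tauMap : J Z → J Z :=
  fun u => (![u.1 0, -u.1 2, -u.1 1, -u.1 3], ![u.2 0, -u.2 2, -u.2 1, -u.2 3])

/-- `g` is an `F`-algebra automorphism of `J = JCK(Z,δ)`. -/
def IsJAut (δ : Z → Z) (g : J Z → J Z) : Prop :=
  IsLin F g ∧ Function.Bijective g ∧ ∀ u v, g (jmul δ u v) = jmul δ (g u) (g v)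

/-- The coordinatization map `Φ : K → Der(J)^{[1,1]}`,
`Φ(f + gy) = D(v₁, f·v₂) + i·D(v₃, g·y)`. -/
def Phi (δ : Z → Z) (i : F) (p : Z × Z) : J Z → J Z :=
  Dgen δ 1 (fw (algebraMap F Z i) 1) (fw (p.1 * algebraMap F Z i) 2) +
    i • Dgen δ 1 (fw (1 : Z) 3) (fx p.2)

/-- `ι₁(z) = φ ∘ Φ(z) ∘ φ⁻¹`, `ι₂(z) = φ² ∘ Φ(z) ∘ φ⁻²`, `ι₃(z) = Φ(z)`
(indexed here by `j = 0, 1, 2` respectively; note `φ⁻¹ = φ²`). -/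
def iot (δ : Z → Z) (i : F) (j : Fin 3) (z : Z × Z) : J Z → J Z :=
  if j = 0 then phiMap F i ∘ Phi F δ i z ∘ (phiMap F i ∘ phiMap F i)
  else if j = 1 then (phiMap F i ∘ phiMap F i) ∘ Phi F δ i z ∘ phiMap F i
  else Phi F δ i z

/-- The embedding `K = Z ⊕ Zx ⊆ J`. -/
def kap : Z × Z → J Z :=
  fun p => (fun j => if j = 0 then p.1 else 0, fun j => if j = 0 then p.2 else 0)

/-- The projection `J → K` onto the `Z ⊕ Zx` coordinates. -/
def pik : J Z → Z × Z := fun u => (u.1 0, u.2 0)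

end CKJ

namespace CKJ

section Formulas

theorem J_ext {Z : Type*} {u v : J Z} (h0 : u.1 0 = v.1 0) (h1 : u.1 1 = v.1 1) (h2 : u.1 2 = v.1 2)
    (h3 : u.1 3 = v.1 3) (k0 : u.2 0 = v.2 0) (k1 : u.2 1 = v.2 1) (k2 : u.2 2 = v.2 2)
    (k3 : u.2 3 = v.2 3) : u = v := by
  refine Prod.ext (funext fun k => ?_) (funext fun k => ?_) <;> fin_cases k <;> assumption

variable {Z : Type*} [CommRing Z]

@[simp] theorem jmul_fst_0 (δ : Z → Z) (u v : J Z) :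
    (jmul δ u v).1 0 = u.1 0 * v.1 0 + u.1 1 * v.1 1 + u.1 2 * v.1 2 - u.1 3 * v.1 3 +
      (δ (u.2 0) * v.2 0 - u.2 0 * δ (v.2 0)) := rfl

@[simp] theorem jmul_fst_1 (δ : Z → Z) (u v : J Z) :
    (jmul δ u v).1 1 = u.1 0 * v.1 1 + u.1 1 * v.1 0 + (u.2 1 * v.2 0 - u.2 0 * v.2 1) := rfl

@[simp] theorem jmul_fst_2 (δ : Z → Z) (u v : J Z) :
    (jmul δ u v).1 2 = u.1 0 * v.1 2 + u.1 2 * v.1 0 + (u.2 2 * v.2 0 - u.2 0 * v.2 2) := rfl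

@[simp] theorem jmul_fst_3 (δ : Z → Z) (u v : J Z) :
    (jmul δ u v).1 3 = u.1 0 * v.1 3 + u.1 3 * v.1 0 + (u.2 3 * v.2 0 - u.2 0 * v.2 3) := rfl

@[simp] theorem jmul_snd_0 (δ : Z → Z) (u v : J Z) :
    (jmul δ u v).2 0 = u.1 0 * v.2 0 + v.1 0 * u.2 0 := rfl

@[simp] theorem jmul_snd_1 (δ : Z → Z) (u v : J Z) :
    (jmul δ u v).2 1 = (u.1 0 * v.2 1 + δ (u.1 1) * v.2 0 + (u.1 2 * v.2 3 - u.1 3 * v.2 2)) +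
      (v.1 0 * u.2 1 + δ (v.1 1) * u.2 0 + (v.1 2 * u.2 3 - v.1 3 * u.2 2)) := rfl

@[simp] theorem jmul_snd_2 (δ : Z → Z) (u v : J Z) :
    (jmul δ u v).2 2 = (u.1 0 * v.2 2 + δ (u.1 2) * v.2 0 + (u.1 3 * v.2 1 - u.1 1 * v.2 3)) +
      (v.1 0 * u.2 2 + δ (v.1 2) * u.2 0 + (v.1 3 * u.2 1 - v.1 1 * u.2 3)) := rfl

@[simp] theorem jmul_snd_3 (δ : Z → Z) (u v : J Z) :
    (jmul δ u v).2 3 = (u.1 0 * v.2 3 + δ (u.1 3) * v.2 0 + (u.1 2 * v.2 1 - u.1 1 * v.2 2)) +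
      (v.1 0 * u.2 3 + δ (v.1 3) * u.2 0 + (v.1 2 * u.2 1 - v.1 1 * u.2 2)) := rfl

/-- The derivation `ι₁(z)` of `J` in coordinates, `I` being the square root of `-1`. -/
def rot0 (δ : Z → Z) (I : Z) (z : Z × Z) (u : J Z) : J Z :=
  (![z.2 * u.2 1,
     -(δ z.2 * u.2 0 - z.2 * δ (u.2 0)),
     -(I * z.1 * u.1 3) + z.2 * u.2 3,
     -(I * z.1 * u.1 2) + z.2 * u.2 2],
   ![z.2 * u.1 1,
     I * δ z.1 * u.2 0 + z.2 * δ (u.1 0),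
     -(I * z.1 * u.2 3) + z.2 * δ (u.1 3),
     -(I * z.1 * u.2 2) + z.2 * δ (u.1 2)])

/-- The derivation `ι₂(z)` of `J` in coordinates. -/
def rot1 (δ : Z → Z) (I : Z) (z : Z × Z) (u : J Z) : J Z :=
  (![z.2 * u.2 2,
     I * z.1 * u.1 3 - z.2 * u.2 3,
     -(δ z.2 * u.2 0 - z.2 * δ (u.2 0)),
     I * z.1 * u.1 1 - z.2 * u.2 1],
   ![z.2 * u.1 2,
     I * z.1 * u.2 3 - z.2 * δ (u.1 3),
     I * δ z.1 * u.2 0 + z.2 * δ (u.1 0),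
     I * z.1 * u.2 1 - z.2 * δ (u.1 1)])

/-- The derivation `ι₃(z)` of `J` in coordinates. -/
def rot2 (δ : Z → Z) (I : Z) (z : Z × Z) (u : J Z) : J Z :=
  (![I * z.2 * u.2 3,
     -(z.1 * u.1 2) - I * z.2 * u.2 2,
     z.1 * u.1 1 + I * z.2 * u.2 1,
     I * (δ z.2 * u.2 0 - z.2 * δ (u.2 0))],
   ![I * z.2 * u.1 3,
     -(z.1 * u.2 2) - I * z.2 * δ (u.1 2),
     z.1 * u.2 1 + I * z.2 * δ (u.1 1),
     δ z.1 * u.2 0 - I * z.2 * δ (u.1 0)])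

/-- The derivation `ι_{j+1}(z)` of `J` in coordinates. -/
def rot (δ : Z → Z) (I : Z) (j : Fin 3) : Z × Z → J Z → J Z :=
  ![rot0 δ I, rot1 δ I, rot2 δ I] j

@[simp] theorem rot0_fst_0 (δ : Z → Z) (I : Z) (z : Z × Z) (u : J Z) :
    (rot0 δ I z u).1 0 = z.2 * u.2 1 := rfl

@[simp] theorem rot0_fst_1 (δ : Z → Z) (I : Z) (z : Z × Z) (u : J Z) :
    (rot0 δ I z u).1 1 = -(δ z.2 * u.2 0 - z.2 * δ (u.2 0)) := rfl

@[simp] theorem rot0_fst_2 (δ : Z → Z) (I : Z) (z : Z × Z) (u : J Z) :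
    (rot0 δ I z u).1 2 = -(I * z.1 * u.1 3) + z.2 * u.2 3 := rfl

@[simp] theorem rot0_fst_3 (δ : Z → Z) (I : Z) (z : Z × Z) (u : J Z) :
    (rot0 δ I z u).1 3 = -(I * z.1 * u.1 2) + z.2 * u.2 2 := rfl

@[simp] theorem rot0_snd_0 (δ : Z → Z) (I : Z) (z : Z × Z) (u : J Z) :
    (rot0 δ I z u).2 0 = z.2 * u.1 1 := rfl

@[simp] theorem rot0_snd_1 (δ : Z → Z) (I : Z) (z : Z × Z) (u : J Z) :
    (rot0 δ I z u).2 1 = I * δ z.1 * u.2 0 + z.2 * δ (u.1 0) := rfl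

@[simp] theorem rot0_snd_2 (δ : Z → Z) (I : Z) (z : Z × Z) (u : J Z) :
    (rot0 δ I z u).2 2 = -(I * z.1 * u.2 3) + z.2 * δ (u.1 3) := rfl

@[simp] theorem rot0_snd_3 (δ : Z → Z) (I : Z) (z : Z × Z) (u : J Z) :
    (rot0 δ I z u).2 3 = -(I * z.1 * u.2 2) + z.2 * δ (u.1 2) := rfl

@[simp] theorem rot1_fst_0 (δ : Z → Z) (I : Z) (z : Z × Z) (u : J Z) :
    (rot1 δ I z u).1 0 = z.2 * u.2 2 := rfl

@[simp] theorem rot1_fst_1 (δ : Z → Z) (I : Z) (z : Z × Z) (u : J Z) :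
    (rot1 δ I z u).1 1 = I * z.1 * u.1 3 - z.2 * u.2 3 := rfl

@[simp] theorem rot1_fst_2 (δ : Z → Z) (I : Z) (z : Z × Z) (u : J Z) :
    (rot1 δ I z u).1 2 = -(δ z.2 * u.2 0 - z.2 * δ (u.2 0)) := rfl

@[simp] theorem rot1_fst_3 (δ : Z → Z) (I : Z) (z : Z × Z) (u : J Z) :
    (rot1 δ I z u).1 3 = I * z.1 * u.1 1 - z.2 * u.2 1 := rfl

@[simp] theorem rot1_snd_0 (δ : Z → Z) (I : Z) (z : Z × Z) (u : J Z) :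
    (rot1 δ I z u).2 0 = z.2 * u.1 2 := rfl

@[simp] theorem rot1_snd_1 (δ : Z → Z) (I : Z) (z : Z × Z) (u : J Z) :
    (rot1 δ I z u).2 1 = I * z.1 * u.2 3 - z.2 * δ (u.1 3) := rfl

@[simp] theorem rot1_snd_2 (δ : Z → Z) (I : Z) (z : Z × Z) (u : J Z) :
    (rot1 δ I z u).2 2 = I * δ z.1 * u.2 0 + z.2 * δ (u.1 0) := rfl

@[simp] theorem rot1_snd_3 (δ : Z → Z) (I : Z) (z : Z × Z) (u : J Z) :
    (rot1 δ I z u).2 3 = I * z.1 * u.2 1 - z.2 * δ (u.1 1) := rfl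

@[simp] theorem rot2_fst_0 (δ : Z → Z) (I : Z) (z : Z × Z) (u : J Z) :
    (rot2 δ I z u).1 0 = I * z.2 * u.2 3 := rfl

@[simp] theorem rot2_fst_1 (δ : Z → Z) (I : Z) (z : Z × Z) (u : J Z) :
    (rot2 δ I z u).1 1 = -(z.1 * u.1 2) - I * z.2 * u.2 2 := rfl

@[simp] theorem rot2_fst_2 (δ : Z → Z) (I : Z) (z : Z × Z) (u : J Z) :
    (rot2 δ I z u).1 2 = z.1 * u.1 1 + I * z.2 * u.2 1 := rfl

@[simp] theorem rot2_fst_3 (δ : Z → Z) (I : Z) (z : Z × Z) (u : J Z) :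
    (rot2 δ I z u).1 3 = I * (δ z.2 * u.2 0 - z.2 * δ (u.2 0)) := rfl

@[simp] theorem rot2_snd_0 (δ : Z → Z) (I : Z) (z : Z × Z) (u : J Z) :
    (rot2 δ I z u).2 0 = I * z.2 * u.1 3 := rfl

@[simp] theorem rot2_snd_1 (δ : Z → Z) (I : Z) (z : Z × Z) (u : J Z) :
    (rot2 δ I z u).2 1 = -(z.1 * u.2 2) - I * z.2 * δ (u.1 2) := rfl

@[simp] theorem rot2_snd_2 (δ : Z → Z) (I : Z) (z : Z × Z) (u : J Z) :
    (rot2 δ I z u).2 2 = z.1 * u.2 1 + I * z.2 * δ (u.1 1) := rfl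

@[simp] theorem rot2_snd_3 (δ : Z → Z) (I : Z) (z : Z × Z) (u : J Z) :
    (rot2 δ I z u).2 3 = δ z.1 * u.2 0 - I * z.2 * δ (u.1 0) := rfl

/-- The derivation `μ̃ + η̃_{Ia}` of `J` attached to an element `e = μ̌ + η_a` of `D̄er(K)`,
where `μ = e|_Z` and `e(x) = a + cx`. -/
def kext (I : Z) (e : Z × Z → Z × Z) (u : J Z) : J Z :=
  (![(e (u.1 0, 0)).1 + I * (e (0, 1)).1 * u.2 0, (e (u.1 1, 0)).1, (e (u.1 2, 0)).1,
     (e (u.1 3, 0)).1],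
   ![(e (u.2 0, 0)).1 + (e (0, 1)).2 * u.2 0,
     (e (u.2 1, 0)).1 - (e (0, 1)).2 * u.2 1 - I * (e (0, 1)).1 * u.1 1,
     (e (u.2 2, 0)).1 - (e (0, 1)).2 * u.2 2 - I * (e (0, 1)).1 * u.1 2,
     (e (u.2 3, 0)).1 - (e (0, 1)).2 * u.2 3 - I * (e (0, 1)).1 * u.1 3])

@[simp] theorem kext_fst_0 (I : Z) (e : Z × Z → Z × Z) (u : J Z) :
    (kext I e u).1 0 = (e (u.1 0, 0)).1 + I * (e (0, 1)).1 * u.2 0 := rfl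

@[simp] theorem kext_fst_1 (I : Z) (e : Z × Z → Z × Z) (u : J Z) :
    (kext I e u).1 1 = (e (u.1 1, 0)).1 := rfl

@[simp] theorem kext_fst_2 (I : Z) (e : Z × Z → Z × Z) (u : J Z) :
    (kext I e u).1 2 = (e (u.1 2, 0)).1 := rfl

@[simp] theorem kext_fst_3 (I : Z) (e : Z × Z → Z × Z) (u : J Z) :
    (kext I e u).1 3 = (e (u.1 3, 0)).1 := rfl

@[simp] theorem kext_snd_0 (I : Z) (e : Z × Z → Z × Z) (u : J Z) :
    (kext I e u).2 0 = (e (u.2 0, 0)).1 + (e (0, 1)).2 * u.2 0 := rfl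

@[simp] theorem kext_snd_1 (I : Z) (e : Z × Z → Z × Z) (u : J Z) :
    (kext I e u).2 1 = (e (u.2 1, 0)).1 - (e (0, 1)).2 * u.2 1 - I * (e (0, 1)).1 * u.1 1 := rfl

@[simp] theorem kext_snd_2 (I : Z) (e : Z × Z → Z × Z) (u : J Z) :
    (kext I e u).2 2 = (e (u.2 2, 0)).1 - (e (0, 1)).2 * u.2 2 - I * (e (0, 1)).1 * u.1 2 := rfl

@[simp] theorem kext_snd_3 (I : Z) (e : Z × Z → Z × Z) (u : J Z) :
    (kext I e u).2 3 = (e (u.2 3, 0)).1 - (e (0, 1)).2 * u.2 3 - I * (e (0, 1)).1 * u.1 3 := rfl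

/-- The element `μ̌ + η_a` of `D̄er(K)`, where `μ̌(x) = cx`. -/
def kmap (μ : Z → Z) (a c : Z) : Z × Z → Z × Z :=
  fun u => (μ u.1 + a * u.2, μ u.2 + c * u.2)

end Formulas

section Derivations

variable {F : Type*} [Field F] {Z : Type*} [CommRing Z] [Algebra F Z]

theorem iot_eq_rot (δ : Derivation F Z Z) {i : F} (hi : i ^ 2 = -1) (j : Fin 3) (z : Z × Z) :
    iot F (⇑δ) i j z = rot (⇑δ) (algebraMap F Z i) j z := by
  have hI : algebraMap F Z i * algebraMap F Z i = -1 := by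
    rw [← map_mul, ← pow_two, hi]; simp
  have hδ : δ (algebraMap F Z i) = 0 := δ.map_algebraMap i
  have hs : ∀ x : Z, i • x = algebraMap F Z i * x := Algebra.smul_def i
  have key : ∀ z : Z × Z, Phi F (⇑δ) i z = rot2 (⇑δ) (algebraMap F Z i) z := by
    intro z
    funext u
    apply J_ext <;>
      simp [Phi, Dgen, fw, fx, fxi, hs, hδ] <;> grind
  fin_cases j <;> funext u <;> apply J_ext <;>
    simp [iot, rot, key, phiMap, hδ] <;> grind

section Rotations

variable (δ : Derivation F Z Z) {I : Z} (hδ : δ I = 0)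

theorem rot_isLin (δ : Derivation F Z Z) (I : Z) (j : Fin 3) (z : Z × Z) :
    IsLin F (rot (⇑δ) I j z) := by
  have hs : ∀ (c : F) (x : Z), c • x = algebraMap F Z c * x := Algebra.smul_def
  constructor
  · intro u v
    fin_cases j <;> apply J_ext <;> simp [rot] <;> ring
  · intro c u
    fin_cases j <;> apply J_ext <;> simp [rot, hs] <;> ring

set_option maxHeartbeats 1000000 in
include hδ in
theorem rot_isDer0 (j : Fin 3) (f : Z) : IsDer0 F (⇑δ) (rot (⇑δ) I j (f, 0)) := by
  refine ⟨rot_isLin δ I j _, ?_, ?_, ?_⟩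
  · intro u hu
    fin_cases j <;> simp [rot, rot0, rot1, rot2, hu]
  · intro u hu
    fin_cases j <;> simp [rot, rot0, rot1, rot2, hu]
  · intro u v
    fin_cases j <;> apply J_ext <;>
      simp [rot, hδ] <;> grind

set_option maxHeartbeats 1000000 in
include hδ in
theorem rot_isDer1 (j : Fin 3) (g : Z) : IsDer1 F (⇑δ) (rot (⇑δ) I j (0, g)) := by
  refine ⟨rot_isLin δ I j _, ?_, ?_, ?_⟩
  · intro u hu
    fin_cases j <;> simp [rot, rot0, rot1, rot2, hu]
  · intro u hu
    fin_cases j <;> simp [rot, rot0, rot1, rot2, hu]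
  · intro u v
    fin_cases j <;> apply J_ext <;>
      simp [rot, jsig, hδ] <;> grind

end Rotations

end Derivations

end CKJ

namespace CKJ

section Bracket

variable {F : Type*} [Field F] {Z : Type*} [CommRing Z] [Algebra F Z]

theorem kext_add (I : Z) (e e' : Z × Z → Z × Z) : kext I (e + e') = kext I e + kext I e' := by
  funext u
  apply J_ext <;> simp <;> ring

theorem kext_smul (I : Z) (c : F) (e : Z × Z → Z × Z) : kext I (c • e) = c • kext I e := by
  have hs : ∀ x : Z, c • x = algebraMap F Z c * x := Algebra.smul_def c
  funext u
  apply J_ext <;> simp [hs] <;> ring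

@[simp] theorem kext_zero (I : Z) : kext I (0 : Z × Z → Z × Z) = 0 := by
  funext u
  apply J_ext <;> simp

theorem rot_add (δ : Derivation F Z Z) (I : Z) (j : Fin 3) (z z' : Z × Z) :
    rot (⇑δ) I j (z + z') = rot (⇑δ) I j z + rot (⇑δ) I j z' := by
  funext u
  fin_cases j <;> apply J_ext <;> simp [rot] <;> ring

theorem rot_smul (δ : Derivation F Z Z) (I : Z) (j : Fin 3) (c : F) (z : Z × Z) :
    rot (⇑δ) I j (c • z) = c • rot (⇑δ) I j z := by
  have hs : ∀ (c : F) (x : Z), c • x = algebraMap F Z c * x := Algebra.smul_def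
  funext u
  fin_cases j <;> apply J_ext <;> simp [rot, hs] <;> ring

@[simp] theorem rot_zero (δ : Derivation F Z Z) (I : Z) (j : Fin 3) :
    rot (⇑δ) I j 0 = 0 := by
  simpa using rot_smul δ I j (0 : F) 0

/-- The map `E₁ ⊗ ζ(0) + E₂ ⊗ ζ(1) + E₃ ⊗ ζ(2) + e ↦ Σ ι_{j+1}(ζ(j)) + kext I e`. -/
def psi (δ : Derivation F Z Z) (I : Z) :
    (Fin 3 → Z × Z) × (Z × Z → Z × Z) →ₗ[F] (J Z → J Z) where
  toFun p := ∑ j, rot (⇑δ) I j (p.1 j) + kext I p.2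
  map_add' p q := by
    simp only [Prod.fst_add, Prod.snd_add, Pi.add_apply, rot_add, kext_add,
      Finset.sum_add_distrib]
    abel
  map_smul' c p := by
    simp only [Prod.smul_fst, Prod.smul_snd, Pi.smul_apply, rot_smul, kext_smul,
      Finset.smul_sum, smul_add, RingHom.id_apply]

theorem psi_apply (δ : Derivation F Z Z) (I : Z) (p : (Fin 3 → Z × Z) × (Z × Z → Z × Z)) :
    psi δ I p = ∑ j, rot (⇑δ) I j (p.1 j) + kext I p.2 := rfl

@[simp] theorem psi_single (δ : Derivation F Z Z) (I : Z) (j : Fin 3) (z : Z × Z) :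
    psi δ I (Pi.single j z, 0) = rot (⇑δ) I j z := by
  rw [psi_apply, Finset.sum_eq_single j]
  · simp
  · intro k _ hk
    simp [Pi.single_eq_of_ne hk]
  · simp

@[simp] theorem psi_zero_left (δ : Derivation F Z Z) (I : Z) (e : Z × Z → Z × Z) :
    psi δ I (0, e) = kext I e := by
  simp [psi_apply]

theorem mem_DerbarK_iff (δ : Derivation F Z Z) (e : Z × Z → Z × Z) :
    e ∈ DerbarK F (⇑δ) ↔ ∃ (μ : Derivation F Z Z) (a c : Z),
      (∀ f, μ (δ f) = δ (μ f) + 2 * c * δ f) ∧ e = kmap (⇑μ) a c := by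
  have hs : ∀ (c : F) (x : Z), c • x = algebraMap F Z c * x := Algebra.smul_def
  constructor
  · rintro ⟨d, a, ⟨⟨hadd, hsmul⟩, hev, hod, hd⟩, rfl⟩
    have e1 : ∀ f, d (f, 0) = ((d (f, 0)).1, 0) := fun f => Prod.ext rfl (hev _ rfl)
    have o1 : ∀ f, d (0, f) = (0, (d (0, f)).2) := fun f => Prod.ext (hod _ rfl) rfl
    let μ : Derivation F Z Z := Derivation.mk'
      { toFun := fun f => (d (f, 0)).1
        map_add' := fun f g => by
          have := hadd (f, 0) (g, 0)
          simp only [Prod.mk_add_mk, add_zero] at this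
          rw [this, Prod.fst_add]
        map_smul' := fun t f => by
          have := hsmul t (f, 0)
          simp only [Prod.smul_mk, smul_zero] at this
          rw [this, Prod.smul_fst, RingHom.id_apply] }
      (fun f g => by
        have := congrArg Prod.fst (hd (f, 0) (g, 0))
        rw [e1 f, e1 g] at this
        simp only [kmul, map_zero, mul_zero, sub_zero, add_zero] at this
        simp only [LinearMap.coe_mk, AddHom.coe_mk, smul_eq_mul, this, Prod.fst_add]
        ring)
    have hμ : ∀ f, d (f, 0) = (μ f, 0) := e1
    have hν : ∀ f, d (0, f) = (0, μ f + (d (0, 1)).2 * f) := by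
      intro f
      have := hd (f, 0) (0, 1)
      rw [hμ f, o1 1] at this
      simp only [kmul, map_zero, mul_zero, zero_mul, sub_zero, add_zero, mul_one] at this
      rw [this]
      ext <;> simp [mul_comm]
    refine ⟨μ, a, (d (0, 1)).2, ?_, ?_⟩
    · intro f
      have := congrArg Prod.fst (hd (0, 1) (0, f))
      rw [hν f, o1 1] at this
      simp only [kmul, mul_zero, zero_mul, zero_sub, zero_add, add_zero,
        one_mul, Derivation.map_one_eq_zero, map_add, Derivation.leibniz, smul_eq_mul] at this
      rw [hμ, map_neg] at this
      simp only [Prod.fst_add] at this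
      linear_combination -this
    · funext u
      have hu : u = (u.1, 0) + (0, u.2) := by simp
      simp only [Pi.add_apply]
      conv_lhs => rw [hu]
      rw [hadd, hμ, hν]
      simp [kmap, keta]
  · rintro ⟨μ, a, c, h, rfl⟩
    refine ⟨kmap (⇑μ) 0 c, a, ⟨⟨?_, ?_⟩, ?_, ?_, ?_⟩, ?_⟩
    · intro u v
      ext <;> simp [kmap]
      ring
    · intro t u
      ext <;> simp [kmap, hs]
      ring
    · intro u hu
      simp [kmap, hu]
    · intro u hu
      simp [kmap, hu]
    · intro u v
      ext <;> simp [kmap, kmul, h] <;> ring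
    · funext u
      ext <;> simp [kmap, keta]

variable {δ μ : Derivation F Z Z} {a c : Z}

theorem kext_kmap_isLin (I : Z) (μ : Derivation F Z Z) (a c : Z) :
    IsLin F (kext I (kmap (⇑μ) a c)) := by
  have hs : ∀ (c : F) (x : Z), c • x = algebraMap F Z c * x := Algebra.smul_def
  constructor
  · intro u v
    apply J_ext <;> simp [kmap] <;> ring
  · intro c u
    apply J_ext <;> simp [kmap, hs] <;> ring

theorem kext_isDer0 (I : Z) (h : ∀ f, μ (δ f) = δ (μ f) + 2 * c * δ f) :
    IsDer0 F (⇑δ) (kext I (kmap (⇑μ) 0 c)) := by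
  refine ⟨kext_kmap_isLin I μ 0 c, ?_, ?_, ?_⟩
  · intro u hu
    simp [kext, kmap, hu]
  · intro u hu
    simp [kext, kmap, hu]
  · intro u v
    apply J_ext <;> simp [kmap, h] <;> ring

theorem kext_isDer1 (δ : Derivation F Z Z) (I a : Z) :
    IsDer1 F (⇑δ) (kext I (kmap (⇑(0 : Derivation F Z Z)) a 0)) := by
  refine ⟨kext_kmap_isLin I 0 a 0, ?_, ?_, ?_⟩
  · intro u hu
    simp [kext, kmap, hu]
  · intro u hu
    simp [kext, kmap, hu]
  · intro u v
    apply J_ext <;> simp [kmap, jsig] <;> ring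

theorem kext_kmap_eq_add (I : Z) (μ : Derivation F Z Z) (a c : Z) : kext I (kmap (⇑μ) a c) =
    kext I (kmap (⇑μ) 0 c) + kext I (kmap (⇑(0 : Derivation F Z Z)) a 0) := by
  rw [← kext_add]
  congr 1
  funext u
  simp [kmap]

theorem odp_eq (h2 : (2 : F) ≠ 0) {X Y : J Z → J Z}
    (h : ∀ u, X u - jsig (X (jsig u)) = Y u + Y u) : odp F X = Y := by
  funext u
  rw [odp, h, ← two_smul F, smul_smul, inv_mul_cancel₀ h2, one_smul]

theorem odp_rot (h2 : (2 : F) ≠ 0) (δ : Derivation F Z Z) (I : Z) (j : Fin 3) (z : Z × Z) :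
    odp F (rot (⇑δ) I j z) = rot (⇑δ) I j (0, z.2) := by
  apply odp_eq h2
  intro u
  fin_cases j <;> apply J_ext <;> simp [rot, jsig] <;> ring

theorem odp_kext (h2 : (2 : F) ≠ 0) (I : Z) (μ : Derivation F Z Z) (a c : Z) :
    odp F (kext I (kmap (⇑μ) a c)) = kext I (kmap (⇑(0 : Derivation F Z Z)) a 0) := by
  apply odp_eq h2
  intro u
  apply J_ext <;> simp [kmap, jsig] <;> ring

end Bracket

end CKJ

namespace CKJ

section Bracket

variable {F : Type*} [Field F] {Z : Type*} [CommRing Z] [Algebra F Z]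

variable {δ μ : Derivation F Z Z} {a c : Z}

theorem sbr_apply (X Y : J Z → J Z) (u : J Z) : sbr F X Y u =
    X (Y u) - Y (X u) + (odp F Y (odp F X u) + odp F Y (odp F X u)) := by
  simp [sbr, two_smul]

set_option maxHeartbeats 1000000 in
theorem sbr_kext_rot (h2 : (2 : F) ≠ 0) (h : ∀ f, μ (δ f) = δ (μ f) + 2 * c * δ f) {I : Z}
    (hI : I * I = -1) (hδ : δ I = 0) (hμ : μ I = 0) (j : Fin 3) (z : Z × Z) :
    sbr F (kext I (kmap (⇑μ) a c)) (rot (⇑δ) I j z) = rot (⇑δ) I j (kmap (⇑μ) a c z) := by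
  funext u
  rw [sbr_apply, odp_rot h2, odp_kext h2]
  fin_cases j <;> apply J_ext <;> simp [rot, kmap, h, hμ, hδ] <;> grind

theorem ksbr_kmap (h2 : (2 : F) ≠ 0) (μ μ' : Derivation F Z Z) (a c a' c' : Z) :
    ksbr F (kmap (⇑μ) a c) (kmap (⇑μ') a' c') =
      kmap (⇑⁅μ, μ'⁆) (μ a' + a * c' - (μ' a + a' * c)) (μ c' - μ' c) := by
  have ho : ∀ (μ : Derivation F Z Z) (a c : Z),
      kodp F (kmap (⇑μ) a c) = kmap (⇑(0 : Derivation F Z Z)) a 0 := by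
    intro μ a c
    funext u
    have : kmap (⇑μ) a c u - ksig (kmap (⇑μ) a c (ksig u)) =
        kmap (⇑(0 : Derivation F Z Z)) a 0 u + kmap (⇑(0 : Derivation F Z Z)) a 0 u := by
      ext <;> simp [kmap, ksig]
      ring
    rw [kodp, this, ← two_smul F, smul_smul, inv_mul_cancel₀ h2, one_smul]
  funext u
  rw [ksbr, ho, ho]
  ext <;> simp [kmap, Derivation.commutator_apply] <;> ring

theorem sbr_kext_kext (h2 : (2 : F) ≠ 0) {I : Z} {μ μ' : Derivation F Z Z} (hμ : μ I = 0)
    (hμ' : μ' I = 0) (a c a' c' : Z) :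
    sbr F (kext I (kmap (⇑μ) a c)) (kext I (kmap (⇑μ') a' c')) =
      kext I (ksbr F (kmap (⇑μ) a c) (kmap (⇑μ') a' c')) := by
  funext u
  rw [ksbr_kmap h2, sbr_apply, odp_kext h2, odp_kext h2]
  apply J_ext <;> simp [kmap, Derivation.commutator_apply, hμ, hμ'] <;> ring

section Rotations

variable (h2 : (2 : F) ≠ 0) (δ : Derivation F Z Z) {I : Z} (hI : I * I = -1) (hδ : δ I = 0)
include h2 hI hδ

set_option maxHeartbeats 1000000 in
theorem sbr_rot_self (j : Fin 3) (z z' : Z × Z) (p q : Bool) (hz : KHom p z) (hz' : KHom q z') :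
    sbr F (rot (⇑δ) I j z) (rot (⇑δ) I j z') = kext I (-Dk (⇑δ) (sgn p q) z z') := by
  funext u
  rw [sbr_apply, odp_rot h2, odp_rot h2]
  obtain ⟨f, g⟩ := z
  obtain ⟨f', g'⟩ := z'
  cases p <;> cases q <;> simp only [KHom, if_true, Bool.false_eq_true, if_false] at hz hz' <;>
    subst hz hz' <;> fin_cases j <;> apply J_ext <;>
    simp [rot, Dk, kmul, sgn, hδ] <;> grind

set_option maxHeartbeats 1000000 in
theorem sbr_rot_succ (j : Fin 3) (z z' : Z × Z) :
    sbr F (rot (⇑δ) I j z) (rot (⇑δ) I (j + 1) z') = rot (⇑δ) I (j + 2) (kmul (⇑δ) z z') := by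
  funext u
  rw [sbr_apply, odp_rot h2, odp_rot h2]
  fin_cases j <;> apply J_ext <;> simp [rot, kmul, hδ] <;> grind

set_option maxHeartbeats 1000000 in
theorem sbr_rot_pred (j : Fin 3) (z z' : Z × Z) :
    sbr F (rot (⇑δ) I j z) (rot (⇑δ) I (j + 2) z') =
      rot (⇑δ) I (j + 1) (-kmul (⇑δ) z z') := by
  funext u
  rw [sbr_apply, odp_rot h2, odp_rot h2]
  fin_cases j <;> apply J_ext <;> simp [rot, kmul, hδ] <;> grind

end Rotations

end Bracket

end CKJ

namespace CKJ

section Surjectivity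

variable {F : Type*} [Field F] {Z : Type*} [CommRing Z] [Algebra F Z]
  {δ : Derivation F Z Z} {d d' : J Z → J Z}

theorem jmul_add_left (δ : Derivation F Z Z) (u v w : J Z) :
    jmul (⇑δ) (u + v) w = jmul (⇑δ) u w + jmul (⇑δ) v w := by
  apply J_ext <;> simp <;> ring

theorem jmul_add_right (δ : Derivation F Z Z) (u v w : J Z) :
    jmul (⇑δ) u (v + w) = jmul (⇑δ) u v + jmul (⇑δ) u w := by
  apply J_ext <;> simp <;> ring

theorem jmul_neg_left (δ : Derivation F Z Z) (u v : J Z) :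
    jmul (⇑δ) (-u) v = -jmul (⇑δ) u v := by
  apply J_ext <;> simp <;> ring

theorem jmul_neg_right (δ : Derivation F Z Z) (u v : J Z) :
    jmul (⇑δ) u (-v) = -jmul (⇑δ) u v := by
  apply J_ext <;> simp <;> ring

theorem IsLin.add (h : IsLin F d) (h' : IsLin F d') : IsLin F (d + d') := by
  constructor
  · intro u v
    simp only [Pi.add_apply, h.1, h'.1]
    abel
  · intro c u
    simp only [Pi.add_apply, h.2, h'.2, smul_add]

theorem IsLin.neg (h : IsLin F d) : IsLin F (-d) := by
  constructor
  · intro u v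
    simp only [Pi.neg_apply, h.1, neg_add]
  · intro c u
    simp only [Pi.neg_apply, h.2, smul_neg]

theorem IsDer0.add (h : IsDer0 F (⇑δ) d) (h' : IsDer0 F (⇑δ) d') : IsDer0 F (⇑δ) (d + d') := by
  refine ⟨h.1.add h'.1, fun u hu => ?_, fun u hu => ?_, fun u v => ?_⟩
  · simp [h.2.1 u hu, h'.2.1 u hu]
  · simp [h.2.2.1 u hu, h'.2.2.1 u hu]
  · simp only [Pi.add_apply, h.2.2.2, h'.2.2.2, jmul_add_left, jmul_add_right]
    abel

theorem IsDer0.neg (h : IsDer0 F (⇑δ) d) : IsDer0 F (⇑δ) (-d) := by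
  refine ⟨h.1.neg, fun u hu => ?_, fun u hu => ?_, fun u v => ?_⟩
  · simp [h.2.1 u hu]
  · simp [h.2.2.1 u hu]
  · simp only [Pi.neg_apply, h.2.2.2, jmul_neg_left, jmul_neg_right]
    abel

theorem IsDer1.add (h : IsDer1 F (⇑δ) d) (h' : IsDer1 F (⇑δ) d') : IsDer1 F (⇑δ) (d + d') := by
  refine ⟨h.1.add h'.1, fun u hu => ?_, fun u hu => ?_, fun u v => ?_⟩
  · simp [h.2.1 u hu, h'.2.1 u hu]
  · simp [h.2.2.1 u hu, h'.2.2.1 u hu]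
  · simp only [Pi.add_apply, h.2.2.2, h'.2.2.2, jmul_add_left, jmul_add_right]
    abel

theorem IsDer1.neg (h : IsDer1 F (⇑δ) d) : IsDer1 F (⇑δ) (-d) := by
  refine ⟨h.1.neg, fun u hu => ?_, fun u hu => ?_, fun u v => ?_⟩
  · simp [h.2.1 u hu]
  · simp [h.2.2.1 u hu]
  · simp only [Pi.neg_apply, h.2.2.2, jmul_neg_left, jmul_neg_right]
    abel

theorem psi_mem_DerJSet {I : Z} (hδ : δ I = 0) {p : (Fin 3 → Z × Z) × (Z × Z → Z × Z)}
    (hp : p.2 ∈ DerbarK F (⇑δ)) : psi δ I p ∈ DerJSet F (⇑δ) := by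
  obtain ⟨ζ, e⟩ := p
  obtain ⟨μ, a, c, h, rfl⟩ := (mem_DerbarK_iff δ e).1 hp
  refine ⟨_, _, (((rot_isDer0 δ hδ 0 (ζ 0).1).add (rot_isDer0 δ hδ 1 (ζ 1).1)).add
    (rot_isDer0 δ hδ 2 (ζ 2).1)).add (kext_isDer0 I h),
    (((rot_isDer1 δ hδ 0 (ζ 0).2).add (rot_isDer1 δ hδ 1 (ζ 1).2)).add
    (rot_isDer1 δ hδ 2 (ζ 2).2)).add (kext_isDer1 δ I a), ?_⟩
  have hr : ∀ j, rot (⇑δ) I j (ζ j) = rot (⇑δ) I j ((ζ j).1, 0) + rot (⇑δ) I j (0, (ζ j).2) := by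
    intro j
    rw [← rot_add, Prod.fst_add_snd]
  rw [psi_apply, Fin.sum_univ_three, kext_kmap_eq_add]
  simp only [hr]
  abel

theorem psi_injOn {I : Z} (hI : I * I = -1) :
    Set.InjOn (psi δ I) {p | p.2 ∈ DerbarK F (⇑δ)} := by
  rintro ⟨ζ, e⟩ hp ⟨ζ', e'⟩ hq h
  obtain ⟨μ, a, c, -, rfl⟩ := (mem_DerbarK_iff δ e).1 hp
  obtain ⟨ν, b, k, -, rfl⟩ := (mem_DerbarK_iff δ e').1 hq
  simp only [psi_apply, Fin.sum_univ_three] at h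
  have h1 := congrFun h (fw 1 1)
  have h2 := congrFun h (fw 1 2)
  have h3 := congrFun h (fw 1 3)
  have hx := congrFun h (fx 1)
  have hz := fun f => congrFun h (fw f 0)
  have a0 : I * (ζ 0).1 = I * (ζ' 0).1 := by
    simpa [rot, fw, kmap] using congrArg (fun u : J Z => u.1 3) h2
  have a1 : I * (ζ 1).1 = I * (ζ' 1).1 := by
    simpa [rot, fw, kmap] using congrArg (fun u : J Z => u.1 3) h1
  have a2 : (ζ 2).1 = (ζ' 2).1 := by
    simpa [rot, fw, kmap] using congrArg (fun u : J Z => u.1 2) h1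
  have b0 : (ζ 0).2 = (ζ' 0).2 := by
    simpa [rot, fw, kmap] using congrArg (fun u : J Z => u.2 0) h1
  have b1 : (ζ 1).2 = (ζ' 1).2 := by
    simpa [rot, fw, kmap] using congrArg (fun u : J Z => u.2 0) h2
  have b2 : I * (ζ 2).2 = I * (ζ' 2).2 := by
    simpa [rot, fw, kmap] using congrArg (fun u : J Z => u.2 0) h3
  have ha : I * a = I * b := by
    simpa [rot, fx, fxi, kmap] using congrArg (fun u : J Z => u.1 0) hx
  have hc : c = k := by
    simpa [rot, fx, fxi, kmap] using congrArg (fun u : J Z => u.2 0) hx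
  have hμ : ∀ f, μ f = ν f := fun f => by
    simpa [rot, fw, kmap] using congrArg (fun u : J Z => u.1 0) (hz f)
  have hcancel : ∀ x y : Z, I * x = I * y → x = y := fun x y hxy => by
    linear_combination (-I) * hxy + (x - y) * hI
  obtain rfl : μ = ν := Derivation.ext hμ
  obtain rfl := hcancel _ _ ha
  subst hc
  congr 1
  funext j
  fin_cases j
  · exact Prod.ext (hcancel _ _ a0) b0
  · exact Prod.ext (hcancel _ _ a1) b1
  · exact Prod.ext a2 (hcancel _ _ b2)

theorem fw_zero_jmul_fw (δ : Derivation F Z Z) (f g : Z) (k : Fin 4) :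
    jmul (⇑δ) (fw f 0) (fw g k) = fw (f * g) k := by
  fin_cases k <;> apply J_ext <;> simp [fw]

theorem fw_zero_jmul_fxi (δ : Derivation F Z Z) (f g : Z) (k : Fin 4) :
    jmul (⇑δ) (fw f 0) (fxi g k) = fxi (f * g) k := by
  fin_cases k <;> apply J_ext <;> simp [fw, fxi]

theorem IsLin.ext_fw_fxi (h : IsLin F d) (h' : IsLin F d')
    (hw : ∀ k f, d (fw f k) = d' (fw f k)) (hx : ∀ k f, d (fxi f k) = d' (fxi f k)) : d = d' := by
  funext u
  have hu : u = (fw (u.1 0) 0 + fw (u.1 1) 1 + fw (u.1 2) 2 + fw (u.1 3) 3) +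
      (fxi (u.2 0) 0 + fxi (u.2 1) 1 + fxi (u.2 2) 2 + fxi (u.2 3) 3) := by
    apply J_ext <;> simp [fw, fxi]
  rw [hu]
  simp only [h.1, h'.1, hw, hx]

theorem IsLin.map_zero (h : IsLin F d) : d 0 = 0 := by
  simpa using h.2 0 0

theorem IsDer0.map_one (h : IsDer0 F (⇑δ) d) : d (fw 1 0) = 0 := by
  have e := h.2.2.2 (fw 1 0) (fw 1 0)
  rw [fw_zero_jmul_fw, one_mul] at e
  have hs := h.2.1 (fw 1 0) rfl
  refine J_ext ?_ ?_ ?_ ?_ (congrFun hs 0) (congrFun hs 1) (congrFun hs 2) (congrFun hs 3)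
  · simpa [fw, hs] using congrArg (fun u : J Z => u.1 0) e
  · simpa [fw, hs] using congrArg (fun u : J Z => u.1 1) e
  · simpa [fw, hs] using congrArg (fun u : J Z => u.1 2) e
  · simpa [fw, hs] using congrArg (fun u : J Z => u.1 3) e

theorem IsDer1.map_one (h : IsDer1 F (⇑δ) d) : d (fw 1 0) = 0 := by
  have e := h.2.2.2 (fw 1 0) (fw 1 0)
  rw [fw_zero_jmul_fw, one_mul] at e
  have hs := h.2.1 (fw 1 0) rfl
  refine J_ext (congrFun hs 0) (congrFun hs 1) (congrFun hs 2) (congrFun hs 3) ?_ ?_ ?_ ?_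
  · simpa [fw, jsig, hs] using congrArg (fun u : J Z => u.2 0) e
  · simpa [fw, jsig, hs] using congrArg (fun u : J Z => u.2 1) e
  · simpa [fw, jsig, hs] using congrArg (fun u : J Z => u.2 2) e
  · simpa [fw, jsig, hs] using congrArg (fun u : J Z => u.2 3) e

end Surjectivity

end CKJ

namespace CKJ

section Surjectivity

variable {F : Type*} [Field F] {Z : Type*} [CommRing Z] [Algebra F Z]
  {δ : Derivation F Z Z} {d : J Z → J Z}

@[simp] theorem fw_fst (f : Z) (k j : Fin 4) : (fw f k).1 j = if j = k then f else 0 := rfl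

@[simp] theorem fw_snd (f : Z) (k : Fin 4) : (fw f k).2 = 0 := rfl

@[simp] theorem fxi_fst (f : Z) (k : Fin 4) : (fxi f k).1 = 0 := rfl

@[simp] theorem fxi_snd (f : Z) (k j : Fin 4) : (fxi f k).2 j = if j = k then f else 0 := rfl

theorem fw_jmul_fw_of_ne (δ : Derivation F Z Z) (f g : Z) {k l : Fin 4} (hk : k ≠ 0) (hl : l ≠ 0)
    (hkl : k ≠ l) : jmul (⇑δ) (fw f k) (fw g l) = 0 := by
  fin_cases k <;> fin_cases l <;> first | contradiction | (apply J_ext <;> simp)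

theorem fw_jmul_fxi_zero (δ : Derivation F Z Z) (f g : Z) {k : Fin 4} (hk : k ≠ 0) :
    jmul (⇑δ) (fw f k) (fxi g 0) = fxi (δ f * g) k := by
  fin_cases k <;> first | contradiction | (apply J_ext <;> simp)

theorem fxi_zero_jmul_fxi_zero (δ : Derivation F Z Z) (f g : Z) :
    jmul (⇑δ) (fxi f 0) (fxi g 0) = fw (δ f * g - f * δ g) 0 := by
  apply J_ext <;> simp

theorem IsLin.map_neg {d : J Z → J Z} (h : IsLin F d) (u : J Z) : d (-u) = -d u := by
  simpa using h.2 (-1) u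

@[simp] theorem jsig_fw (f : Z) (k : Fin 4) : jsig (fw f k) = fw f k := by
  apply J_ext <;> simp [jsig]

theorem fw_add (f g : Z) (k : Fin 4) : fw (f + g) k = fw f k + fw g k := by
  fin_cases k <;> apply J_ext <;> simp

theorem fw_smul (t : F) (f : Z) (k : Fin 4) : fw (t • f) k = t • fw f k := by
  fin_cases k <;> apply J_ext <;> simp

theorem fxi_add (f g : Z) (k : Fin 4) : fxi (f + g) k = fxi f k + fxi g k := by
  fin_cases k <;> apply J_ext <;> simp

theorem fxi_smul (t : F) (f : Z) (k : Fin 4) : fxi (t • f) k = t • fxi f k := by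
  fin_cases k <;> apply J_ext <;> simp

@[simp] theorem fw_zero (k : Fin 4) : fw (0 : Z) k = 0 := by
  apply J_ext <;> simp

@[simp] theorem fxi_zero (k : Fin 4) : fxi (0 : Z) k = 0 := by
  apply J_ext <;> simp

@[simp] theorem jmul_zero_right (δ : Derivation F Z Z) (u : J Z) : jmul (⇑δ) u 0 = 0 := by
  apply J_ext <;> simp

@[simp] theorem jmul_zero_left (δ : Derivation F Z Z) (u : J Z) : jmul (⇑δ) 0 u = 0 := by
  apply J_ext <;> simp

/-- An even derivation of `J` killing `w₁, w₂, w₃` is determined by its restriction to `K`. -/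
theorem IsDer0.eq_kext (hspan : Submodule.span F {z : Z | ∃ f g : Z, z = f * δ g} = ⊤) (I : Z)
    (h : IsDer0 F (⇑δ) d) (hw : ∀ k, k ≠ 0 → d (fw 1 k) = 0) :
    ∃ (μ : Derivation F Z Z) (c : Z), (∀ f, μ (δ f) = δ (μ f) + 2 * c * δ f) ∧
      d = kext I (kmap (⇑μ) 0 c) := by
  have hmul := h.2.2.2
  have hfk : ∀ f k, k ≠ 0 → d (fw f k) = jmul (⇑δ) (d (fw f 0)) (fw 1 k) := fun f k hk => by
    have e := hmul (fw f 0) (fw 1 k)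
    rwa [fw_zero_jmul_fw, mul_one, hw k hk, jmul_zero_right, add_zero] at e
  have hkl : ∀ f k l, k ≠ 0 → l ≠ 0 → k ≠ l →
      jmul (⇑δ) (jmul (⇑δ) (d (fw f 0)) (fw 1 k)) (fw 1 l) = 0 := fun f k l hk hl hne => by
    have e := hmul (fw f k) (fw 1 l)
    rwa [fw_jmul_fw_of_ne δ f 1 hk hl hne, h.1.map_zero, hw l hl, jmul_zero_right, add_zero,
      hfk f k hk, eq_comm] at e
  have hf0 : ∀ f, d (fw f 0) = fw ((d (fw f 0)).1 0) 0 := fun f => by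
    have hs := h.2.1 (fw f 0) rfl
    have e1 : (d (fw f 0)).1 1 = 0 := by
      simpa using congrArg (fun u : J Z => u.1 2) (hkl f 1 2 (by decide) (by decide) (by decide))
    have e2 : (d (fw f 0)).1 2 = 0 := by
      simpa using congrArg (fun u : J Z => u.1 1) (hkl f 2 1 (by decide) (by decide) (by decide))
    have e3 : (d (fw f 0)).1 3 = 0 := by
      simpa using congrArg (fun u : J Z => u.1 1) (hkl f 3 1 (by decide) (by decide) (by decide))
    apply J_ext <;> simp [hs, e1, e2, e3]
  let μ : Derivation F Z Z := Derivation.mk'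
    { toFun := fun f => (d (fw f 0)).1 0
      map_add' := fun f g => by
        rw [fw_add, h.1.1]
        rfl
      map_smul' := fun t f => by
        rw [fw_smul, h.1.2]
        rfl }
    (fun f g => by
      have e := hmul (fw f 0) (fw g 0)
      rw [fw_zero_jmul_fw, hf0 f, hf0 g] at e
      have e' := congrArg (fun u : J Z => u.1 0) e
      simp at e'
      simp only [LinearMap.coe_mk, AddHom.coe_mk, smul_eq_mul]
      linear_combination e')
  have hμ0 : ∀ f, d (fw f 0) = fw (μ f) 0 := hf0
  have hμ : ∀ k f, d (fw f k) = fw (μ f) k := fun k f => by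
    by_cases hk : k = 0
    · rw [hk, hμ0]
    · rw [hfk f k hk, hμ0, fw_zero_jmul_fw, mul_one]
  have hx : d (fxi 1 0) = fxi ((d (fxi 1 0)).2 0) 0 := by
    have hs := h.2.2.1 (fxi 1 0) rfl
    have e : ∀ k, k ≠ 0 → jmul (⇑δ) (fw 1 k) (d (fxi 1 0)) = 0 := fun k hk => by
      have e := hmul (fw 1 k) (fxi 1 0)
      rwa [fw_jmul_fxi_zero δ 1 1 hk, hw k hk, jmul_zero_left, zero_add,
        Derivation.map_one_eq_zero, zero_mul, fxi_zero, h.1.map_zero, eq_comm] at e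
    have e1 : (d (fxi 1 0)).2 1 = 0 := by
      simpa using congrArg (fun u : J Z => u.2 3) (e 2 (by decide))
    have e2 : (d (fxi 1 0)).2 2 = 0 := by
      simpa using congrArg (fun u : J Z => u.2 3) (e 1 (by decide))
    have e3 : (d (fxi 1 0)).2 3 = 0 := by
      simpa using congrArg (fun u : J Z => u.2 2) (e 1 (by decide))
    apply J_ext <;> simp [hs, e1, e2, e3]
  obtain ⟨c, hc⟩ : ∃ c, d (fxi 1 0) = fxi c 0 := ⟨_, hx⟩
  have hgx : ∀ g, d (fxi g 0) = fxi (μ g + c * g) 0 := fun g => by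
    have e := hmul (fw g 0) (fxi 1 0)
    rw [fw_zero_jmul_fxi, mul_one, hμ0, hc, fw_zero_jmul_fxi, fw_zero_jmul_fxi] at e
    rw [e]
    apply J_ext <;> simp [mul_comm]
  have hcomm : ∀ f, μ (δ f) = δ (μ f) + 2 * c * δ f := fun f => by
    have e := hmul (fxi 1 0) (fxi f 0)
    rw [fxi_zero_jmul_fxi_zero, hμ0, hc, hgx, fxi_zero_jmul_fxi_zero, fxi_zero_jmul_fxi_zero] at e
    have e' := congrArg (fun u : J Z => u.1 0) e
    simp at e'
    linear_combination -e'
  have hxk : ∀ k, k ≠ 0 → ∀ g, d (fxi g k) = fxi (μ g - c * g) k := by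
    intro k hk g
    have hg : g ∈ Submodule.span F {z : Z | ∃ f g : Z, z = f * δ g} := hspan ▸ Submodule.mem_top
    induction hg using Submodule.span_induction with
    | mem x hx =>
      obtain ⟨p, q, rfl⟩ := hx
      have e := hmul (fw q k) (fxi 1 0)
      have e' := hmul (fw p 0) (fxi (δ q) k)
      rw [fw_jmul_fxi_zero δ q 1 hk, hμ, hc, fw_jmul_fxi_zero δ _ 1 hk, fw_jmul_fxi_zero δ _ c hk,
        mul_one, mul_one] at e
      rw [fw_zero_jmul_fxi, hμ, e, jmul_add_right] at e'
      rw [e', fw_zero_jmul_fxi, fw_zero_jmul_fxi, fw_zero_jmul_fxi, ← fxi_add, ← fxi_add]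
      congr 1
      rw [Derivation.leibniz, hcomm, smul_eq_mul, smul_eq_mul]
      ring
    | zero => simp [h.1.map_zero]
    | add x y _ _ hx hy =>
      rw [fxi_add, h.1.1, hx, hy, ← fxi_add]
      congr 1
      rw [map_add]
      ring
    | smul t x _ hx =>
      rw [fxi_smul, h.1.2, hx, ← fxi_smul, smul_sub, mul_smul_comm, μ.map_smul]
  refine ⟨μ, c, hcomm, h.1.ext_fw_fxi (kext_kmap_isLin I μ 0 c) ?_ ?_⟩
  · intro k f
    rw [hμ]
    fin_cases k <;> apply J_ext <;> simp [kmap]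
  · intro k f
    by_cases hk : k = 0
    · rw [hk, hgx]
      apply J_ext <;> simp [kmap]
    · rw [hxk k hk]
      fin_cases k <;> first | contradiction | (apply J_ext <;> simp [kmap])

/-- An odd derivation of `J` killing `w₁, w₂, w₃` is zero. -/
theorem IsDer1.eq_zero (h : IsDer1 F (⇑δ) d) (hw : ∀ k, k ≠ 0 → d (fw 1 k) = 0) : d = 0 := by
  have hmul := h.2.2.2
  have hfk : ∀ f k, k ≠ 0 → d (fw f k) = jmul (⇑δ) (d (fw f 0)) (fw 1 k) := fun f k hk => by
    have e := hmul (fw f 0) (fw 1 k)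
    rwa [fw_zero_jmul_fw, mul_one, hw k hk, jmul_zero_right, add_zero] at e
  have hkl : ∀ f k l, k ≠ 0 → l ≠ 0 → k ≠ l →
      jmul (⇑δ) (jmul (⇑δ) (d (fw f 0)) (fw 1 k)) (fw 1 l) = 0 := fun f k l hk hl hne => by
    have e := hmul (fw f k) (fw 1 l)
    rwa [fw_jmul_fw_of_ne δ f 1 hk hl hne, h.1.map_zero, hw l hl, jmul_zero_right, add_zero,
      hfk f k hk, eq_comm] at e
  have hf0 : ∀ f, d (fw f 0) = fxi ((d (fw f 0)).2 0) 0 := fun f => by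
    have hs := h.2.1 (fw f 0) rfl
    have e1 : (d (fw f 0)).2 1 = 0 := by
      simpa [hs] using congrArg (fun u : J Z => u.2 2) (hkl f 2 1 (by decide) (by decide) (by decide))
    have e2 : (d (fw f 0)).2 2 = 0 := by
      simpa [hs] using congrArg (fun u : J Z => u.2 1) (hkl f 1 2 (by decide) (by decide) (by decide))
    have e3 : (d (fw f 0)).2 3 = 0 := by
      simpa [hs] using congrArg (fun u : J Z => u.2 1) (hkl f 1 3 (by decide) (by decide) (by decide))
    apply J_ext <;> simp [hs, e1, e2, e3]
  have hwx : ∀ k g l, k ≠ 0 → d (jmul (⇑δ) (fw 1 k) (fxi g l)) =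
      jmul (⇑δ) (fw 1 k) (d (fxi g l)) := fun k g l hk => by
    rw [hmul, hw k hk, jmul_zero_left, zero_add, jsig_fw]
  have hs3 := fun g => h.2.2.1 (fxi g 3) rfl
  have hs2 := fun g => h.2.2.1 (fxi g 2) rfl
  have hs1 := fun g => h.2.2.1 (fxi g 1) rfl
  have m33 : ∀ g : Z, jmul (⇑δ) (fw 1 3) (fxi g 3) = 0 := fun g => by
    apply J_ext <;> simp
  have m22 : ∀ g : Z, jmul (⇑δ) (fw 1 2) (fxi g 2) = 0 := fun g => by
    apply J_ext <;> simp
  have m12 : ∀ g : Z, jmul (⇑δ) (fw 1 1) (fxi g 2) = -fxi g 3 := fun g => by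
    apply J_ext <;> simp
  have m13 : ∀ g : Z, jmul (⇑δ) (fw 1 1) (fxi g 3) = -fxi g 2 := fun g => by
    apply J_ext <;> simp
  have m23 : ∀ g : Z, jmul (⇑δ) (fw 1 2) (fxi g 3) = fxi g 1 := fun g => by
    apply J_ext <;> simp
  have hx3 : ∀ g, d (fxi g 3) = 0 := fun g => by
    have e1 := hwx 3 g 3 (by decide)
    have e2 := hwx 2 g 2 (by decide)
    have e3 := hwx 1 g 2 (by decide)
    rw [m33, h.1.map_zero] at e1
    rw [m22, h.1.map_zero] at e2
    rw [m12, h.1.map_neg] at e3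
    have c0 : (d (fxi g 3)).1 0 = 0 := by
      simpa [eq_comm] using congrArg (fun u : J Z => u.1 3) e1
    have c1 : (d (fxi g 2)).1 0 = 0 := by
      simpa [eq_comm] using congrArg (fun u : J Z => u.1 2) e2
    have c2 : (d (fxi g 3)).1 1 = 0 := by
      simpa [c1] using congrArg (fun u : J Z => u.1 1) e3
    have c3 : (d (fxi g 3)).1 2 = 0 := by
      simpa using congrArg (fun u : J Z => u.1 2) e3
    have c4 : (d (fxi g 3)).1 3 = 0 := by
      simpa using congrArg (fun u : J Z => u.1 3) e3
    apply J_ext <;> simp [hs3, c0, c2, c3, c4]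
  have hx2 : ∀ g, d (fxi g 2) = 0 := fun g => by
    have e := hwx 1 g 3 (by decide)
    rwa [m13, hx3, jmul_zero_right, h.1.map_neg, neg_eq_zero] at e
  have hx1 : ∀ g, d (fxi g 1) = 0 := fun g => by
    have e := hwx 2 g 3 (by decide)
    rwa [m23, hx3, jmul_zero_right] at e
  have hz : ∀ f, d (fw f 0) = 0 := fun f => by
    have e := hmul (fw f 0) (fxi 1 3)
    rw [fw_zero_jmul_fxi, hx3, hx3, jmul_zero_right, add_zero, hf0] at e
    have e' : (d (fw f 0)).2 0 = 0 := by simpa using congrArg (fun u : J Z => u.1 3) e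
    rw [hf0, e', fxi_zero]
  have hwk : ∀ k f, d (fw f k) = 0 := fun k f => by
    by_cases hk : k = 0
    · rw [hk, hz]
    · rw [hfk f k hk, hz, jmul_zero_left]
  have hx : ∀ g, d (fxi g 0) = 0 := fun g => by
    have e : ∀ k, k ≠ 0 → jmul (⇑δ) (fw 1 k) (d (fxi 1 0)) = 0 := fun k hk => by
      rw [← hwx k 1 0 hk, fw_jmul_fxi_zero δ 1 1 hk, Derivation.map_one_eq_zero, zero_mul,
        fxi_zero, h.1.map_zero]
    have hs := h.2.2.1 (fxi 1 0) rfl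
    have c0 : (d (fxi 1 0)).1 0 = 0 := by
      simpa using congrArg (fun u : J Z => u.1 1) (e 1 (by decide))
    have c1 : (d (fxi 1 0)).1 1 = 0 := by
      simpa using congrArg (fun u : J Z => u.1 0) (e 1 (by decide))
    have c2 : (d (fxi 1 0)).1 2 = 0 := by
      simpa using congrArg (fun u : J Z => u.1 0) (e 2 (by decide))
    have c3 : (d (fxi 1 0)).1 3 = 0 := by
      simpa using congrArg (fun u : J Z => u.1 0) (e 3 (by decide))
    have hx1 : d (fxi 1 0) = 0 := by
      apply J_ext <;> simp [hs, c0, c1, c2, c3]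
    have e := hmul (fw g 0) (fxi 1 0)
    rwa [fw_zero_jmul_fxi, mul_one, hz, hx1, jmul_zero_left, jmul_zero_right, add_zero] at e
  refine h.1.ext_fw_fxi ⟨by simp, by simp⟩ ?_ ?_
  · intro k f
    exact hwk k f
  · intro k f
    fin_cases k
    · exact hx f
    · exact hx1 f
    · exact hx2 f
    · exact hx3 f

end Surjectivity

end CKJ

namespace CKJ

section Surjectivity

variable {F : Type*} [Field F] {Z : Type*} [CommRing Z] [Algebra F Z]
  {δ : Derivation F Z Z} {d : J Z → J Z}

theorem eq_zero_of_add_self (h2 : (2 : F) ≠ 0) {z : Z} (h : z + z = 0) : z = 0 := by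
  rw [← two_smul F] at h
  exact (smul_eq_zero_iff_right h2).1 h

theorem fw_jmul_fw_self (δ : Derivation F Z Z) {k : Fin 4} (hk : k ≠ 0) :
    jmul (⇑δ) (fw 1 k) (fw 1 k) = fw 1 0 ∨ jmul (⇑δ) (fw 1 k) (fw 1 k) = -fw 1 0 := by
  fin_cases k
  · contradiction
  · left; apply J_ext <;> simp
  · left; apply J_ext <;> simp
  · right; apply J_ext <;> simp

theorem IsDer0.exists_rot (h2 : (2 : F) ≠ 0) {I : Z} (hI : I * I = -1) (h : IsDer0 F (⇑δ) d) :
    ∃ f : Fin 3 → Z, ∀ k, k ≠ 0 → d (fw 1 k) = ∑ j, rot (⇑δ) I j (f j, 0) (fw 1 k) := by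
  have hmul := h.2.2.2
  have hs := fun k => h.2.1 (fw 1 k) rfl
  have hself : ∀ k, k ≠ 0 →
      jmul (⇑δ) (d (fw 1 k)) (fw 1 k) + jmul (⇑δ) (fw 1 k) (d (fw 1 k)) = 0 := fun k hk => by
    rw [← hmul]
    rcases fw_jmul_fw_self δ hk with e | e <;> simp [e, h.1.map_neg, h.map_one]
  have hne : ∀ k l, k ≠ 0 → l ≠ 0 → k ≠ l →
      jmul (⇑δ) (d (fw 1 k)) (fw 1 l) + jmul (⇑δ) (fw 1 k) (d (fw 1 l)) = 0 :=
    fun k l hk hl hkl => by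
      rw [← hmul, fw_jmul_fw_of_ne δ 1 1 hk hl hkl, h.1.map_zero]
  have a10 : (d (fw 1 1)).1 0 = 0 := eq_zero_of_add_self h2 <| by
    simpa using congrArg (fun u : J Z => u.1 1) (hself 1 (by decide))
  have a11 : (d (fw 1 1)).1 1 = 0 := eq_zero_of_add_self h2 <| by
    simpa using congrArg (fun u : J Z => u.1 0) (hself 1 (by decide))
  have a20 : (d (fw 1 2)).1 0 = 0 := eq_zero_of_add_self h2 <| by
    simpa using congrArg (fun u : J Z => u.1 2) (hself 2 (by decide))
  have a22 : (d (fw 1 2)).1 2 = 0 := eq_zero_of_add_self h2 <| by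
    simpa using congrArg (fun u : J Z => u.1 0) (hself 2 (by decide))
  have a30 : (d (fw 1 3)).1 0 = 0 := eq_zero_of_add_self h2 <| by
    simpa using congrArg (fun u : J Z => u.1 3) (hself 3 (by decide))
  have a33 : (d (fw 1 3)).1 3 = 0 := eq_zero_of_add_self h2 <| by
    have := congrArg (fun u : J Z => u.1 0) (hself 3 (by decide))
    simp at this
    linear_combination -this
  have b12 : (d (fw 1 1)).1 2 + (d (fw 1 2)).1 1 = 0 := by
    simpa using congrArg (fun u : J Z => u.1 0) (hne 1 2 (by decide) (by decide) (by decide))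
  have b13 : -(d (fw 1 1)).1 3 + (d (fw 1 3)).1 1 = 0 := by
    simpa using congrArg (fun u : J Z => u.1 0) (hne 1 3 (by decide) (by decide) (by decide))
  have b23 : -(d (fw 1 2)).1 3 + (d (fw 1 3)).1 2 = 0 := by
    simpa using congrArg (fun u : J Z => u.1 0) (hne 2 3 (by decide) (by decide) (by decide))
  refine ⟨![I * (d (fw 1 2)).1 3, -(I * (d (fw 1 1)).1 3), (d (fw 1 1)).1 2], fun k hk => ?_⟩
  rw [Fin.sum_univ_three]
  fin_cases k
  · contradiction
  · apply J_ext <;> simp [rot, hs, a10, a11]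
    linear_combination (d (fw 1 1)).1 3 * hI
  · apply J_ext <;> simp [rot, hs, a20, a22] <;> grind
  · apply J_ext <;> simp [rot, hs, a30, a33] <;> grind

theorem IsDer1.exists_rot (h2 : (2 : F) ≠ 0) {I : Z} (hI : I * I = -1) (h : IsDer1 F (⇑δ) d) :
    ∃ (g : Fin 3 → Z) (a : Z), ∀ k, k ≠ 0 → d (fw 1 k) =
      (∑ j, rot (⇑δ) I j (0, g j) + kext I (kmap (⇑(0 : Derivation F Z Z)) a 0)) (fw 1 k) := by
  have hmul := h.2.2.2
  have hs := fun k => h.2.1 (fw 1 k) rfl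
  have hself : ∀ k, k ≠ 0 →
      jmul (⇑δ) (d (fw 1 k)) (fw 1 k) + jmul (⇑δ) (fw 1 k) (d (fw 1 k)) = 0 := fun k hk => by
    have e := hmul (fw 1 k) (fw 1 k)
    rw [jsig_fw] at e
    rw [← e]
    rcases fw_jmul_fw_self δ hk with e | e <;> simp [e, h.1.map_neg, h.map_one]
  have hne : ∀ k l, k ≠ 0 → l ≠ 0 → k ≠ l →
      jmul (⇑δ) (d (fw 1 k)) (fw 1 l) + jmul (⇑δ) (fw 1 k) (d (fw 1 l)) = 0 :=
    fun k l hk hl hkl => by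
      have e := hmul (fw 1 k) (fw 1 l)
      rw [jsig_fw] at e
      rw [← e, fw_jmul_fw_of_ne δ 1 1 hk hl hkl, h.1.map_zero]
  have a12 : (d (fw 1 1)).2 2 = 0 := eq_zero_of_add_self h2 <| by
    have := congrArg (fun u : J Z => u.2 3) (hself 1 (by decide))
    simp [hs] at this
    linear_combination -this
  have a13 : (d (fw 1 1)).2 3 = 0 := eq_zero_of_add_self h2 <| by
    have := congrArg (fun u : J Z => u.2 2) (hself 1 (by decide))
    simp [hs] at this
    linear_combination -this
  have a21 : (d (fw 1 2)).2 1 = 0 := eq_zero_of_add_self h2 <| by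
    have := congrArg (fun u : J Z => u.2 3) (hself 2 (by decide))
    simp [hs] at this
    linear_combination this
  have a23 : (d (fw 1 2)).2 3 = 0 := eq_zero_of_add_self h2 <| by
    have := congrArg (fun u : J Z => u.2 1) (hself 2 (by decide))
    simp [hs] at this
    linear_combination this
  have a31 : (d (fw 1 3)).2 1 = 0 := eq_zero_of_add_self h2 <| by
    have := congrArg (fun u : J Z => u.2 2) (hself 3 (by decide))
    simp [hs] at this
    linear_combination this
  have a32 : (d (fw 1 3)).2 2 = 0 := eq_zero_of_add_self h2 <| by
    have := congrArg (fun u : J Z => u.2 1) (hself 3 (by decide))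
    simp [hs] at this
    linear_combination -this
  have b12 : (d (fw 1 1)).2 1 - (d (fw 1 2)).2 2 = 0 := by
    have := congrArg (fun u : J Z => u.2 3) (hne 1 2 (by decide) (by decide) (by decide))
    simp [hs] at this
    linear_combination this
  have b13 : (d (fw 1 1)).2 1 - (d (fw 1 3)).2 3 = 0 := by
    have := congrArg (fun u : J Z => u.2 2) (hne 1 3 (by decide) (by decide) (by decide))
    simp [hs] at this
    linear_combination this
  refine ⟨![(d (fw 1 1)).2 0, (d (fw 1 2)).2 0, -(I * (d (fw 1 3)).2 0)],
    I * (d (fw 1 1)).2 1, fun k hk => ?_⟩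
  rw [Fin.sum_univ_three]
  fin_cases k
  · contradiction
  · apply J_ext <;> simp [rot, hs, a12, a13, kmap]
    grind
  · apply J_ext <;> simp [rot, hs, a21, a23, kmap]
    grind
  · apply J_ext <;> simp [rot, hs, a31, a32, kmap] <;> grind

theorem psi_surjOn (h2 : (2 : F) ≠ 0)
    (hspan : Submodule.span F {z : Z | ∃ f g : Z, z = f * δ g} = ⊤)
    {I : Z} (hI : I * I = -1) (hδ : δ I = 0) :
    Set.SurjOn (psi δ I) {p | p.2 ∈ DerbarK F (⇑δ)} (DerJSet F (⇑δ)) := by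
  rintro d ⟨d0, d1, h0, h1, rfl⟩
  obtain ⟨f, hf⟩ := h0.exists_rot h2 hI
  obtain ⟨g, a, hg⟩ := h1.exists_rot h2 hI
  have r0 : IsDer0 F (⇑δ) (∑ j, rot (⇑δ) I j (f j, 0)) := by
    rw [Fin.sum_univ_three]
    exact ((rot_isDer0 δ hδ 0 _).add (rot_isDer0 δ hδ 1 _)).add (rot_isDer0 δ hδ 2 _)
  have r1 : IsDer1 F (⇑δ) (∑ j, rot (⇑δ) I j (0, g j) +
      kext I (kmap (⇑(0 : Derivation F Z Z)) a 0)) := by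
    rw [Fin.sum_univ_three]
    exact (((rot_isDer1 δ hδ 0 _).add (rot_isDer1 δ hδ 1 _)).add (rot_isDer1 δ hδ 2 _)).add
      (kext_isDer1 δ I a)
  obtain ⟨μ, c, hμ, he⟩ := (h0.add r0.neg).eq_kext hspan I fun k hk => by
    rw [Pi.add_apply, Pi.neg_apply, hf k hk, Finset.sum_apply, add_neg_cancel]
  have ho := (h1.add r1.neg).eq_zero fun k hk => by
    rw [Pi.add_apply, Pi.neg_apply, hg k hk, add_neg_cancel]
  refine ⟨(fun j => (f j, g j), kmap (⇑μ) a c), (mem_DerbarK_iff δ _).2 ⟨μ, a, c, hμ, rfl⟩, ?_⟩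
  have hr : ∀ j, rot (⇑δ) I j (f j, g j) = rot (⇑δ) I j (f j, 0) + rot (⇑δ) I j (0, g j) := by
    intro j
    rw [← rot_add, Prod.mk_add_mk, add_zero, zero_add]
  rw [psi_apply, kext_kmap_eq_add, ← he]
  simp only [hr, Finset.sum_add_distrib]
  rw [add_neg_eq_zero] at ho
  rw [ho]
  abel

end Surjectivity

end CKJ

namespace CKJ

section Inner

variable {F : Type*} [Field F] {Z : Type*} [CommRing Z] [Algebra F Z]

theorem keta_mem_span_inderKSet {δ : Derivation F Z Z}
    (hspan : Submodule.span F {z : Z | ∃ f g : Z, z = f * δ g} = ⊤) (b : Z) :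
    keta b ∈ Submodule.span F (InderKSet (⇑δ)) := by
  have hb : b ∈ Submodule.span F {z : Z | ∃ f g : Z, z = f * δ g} := hspan ▸ Submodule.mem_top
  induction hb using Submodule.span_induction with
  | mem x hx =>
    obtain ⟨g, f, rfl⟩ := hx
    refine Submodule.subset_span ⟨(f, 0), (0, g), false, true, rfl, rfl, ?_⟩
    funext u
    ext <;> simp [keta, Dk, kmul, sgn] <;> ring
  | zero =>
    convert Submodule.zero_mem _
    funext u
    simp [keta]
  | add x y _ _ hx hy =>
    convert Submodule.add_mem _ hx hy
    funext u
    simp [keta, add_mul]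
  | smul t x _ hx =>
    convert Submodule.smul_mem _ t hx
    funext u
    simp [keta]

variable (δ : Derivation F Z Z) {I : Z} (hI : I * I = -1) (hδ : δ I = 0)
include hI hδ

set_option maxHeartbeats 1000000 in
theorem Dgen_even_even (a c : Fin 4 → Z) : Dgen (⇑δ) 1 (a, 0) (c, 0) =
    psi δ I (![(-(I * (a 2 * c 3 - a 3 * c 2)), 0), (I * (a 1 * c 3 - a 3 * c 1), 0),
      (-(a 1 * c 2 - a 2 * c 1), 0)], 0) := by
  rw [psi_apply, Fin.sum_univ_three, kext_zero]
  funext u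
  apply J_ext <;> simp [rot, Dgen, hδ] <;> grind

set_option maxHeartbeats 1000000 in
theorem Dgen_even_odd (a d : Fin 4 → Z) : Dgen (⇑δ) 1 (a, 0) (0, d) =
    psi δ I (![(0, -(a 1 * d 0)), (0, -(a 2 * d 0)), (0, -(I * (a 3 * d 0)))],
      keta (-(I * (d 0 * δ (a 0) + a 1 * d 1 + a 2 * d 2 - a 3 * d 3)))) := by
  rw [psi_apply, Fin.sum_univ_three]
  funext u
  apply J_ext <;> simp [rot, Dgen, keta, hδ] <;> grind

set_option maxHeartbeats 1000000 in
theorem Dgen_odd_odd (b d : Fin 4 → Z) : Dgen (⇑δ) (-1) (0, b) (0, d) =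
    psi δ I (![(-(I * (b 1 * d 0 + b 0 * d 1)), 0), (-(I * (b 2 * d 0 + b 0 * d 2)), 0),
      (b 3 * d 0 + b 0 * d 3, 0)], Dk (⇑δ) (-1) (0, b 0) (0, d 0)) := by
  rw [psi_apply, Fin.sum_univ_three]
  funext u
  apply J_ext <;> simp [rot, Dgen, Dk, kmul, hδ] <;> grind

end Inner

end CKJ

namespace CKJ

section Inner

variable {F : Type*} [Field F] {Z : Type*} [CommRing Z] [Algebra F Z]

variable (δ : Derivation F Z Z) {I : Z} (hI : I * I = -1) (hδ : δ I = 0)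
include hδ in
set_option maxHeartbeats 1000000 in
theorem kext_Dk_mem_inderSet {u v : Z × Z} {p q : Bool} (hu : KHom p u) (hv : KHom q v) :
    kext I (Dk (⇑δ) (sgn p q) u v) ∈ InderSet (⇑δ) := by
  obtain ⟨f, g⟩ := u
  obtain ⟨f', g'⟩ := v
  cases p <;> cases q <;> simp only [KHom, if_true, Bool.false_eq_true, if_false] at hu hv <;>
    subst hu hv
  · refine ⟨0, 0, false, false, rfl, rfl, ?_⟩
    funext w
    apply J_ext <;> simp [Dgen, Dk, kmul, sgn] <;> ring
  · refine ⟨fw f 0, fx (I * g'), false, true, rfl, rfl, ?_⟩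
    funext w
    apply J_ext <;> simp [Dgen, Dk, kmul, sgn, fx, hδ] <;> grind
  · refine ⟨fx (I * g), fw f' 0, true, false, rfl, rfl, ?_⟩
    funext w
    apply J_ext <;> simp [Dgen, Dk, kmul, sgn, fx, hδ] <;> grind
  · refine ⟨fx g, fx g', true, true, rfl, rfl, ?_⟩
    funext w
    apply J_ext <;> simp [Dgen, Dk, kmul, sgn, fx] <;> ring

include hδ in
set_option maxHeartbeats 1000000 in
theorem rot_mem_span_inderSet (j : Fin 3) (z : Z × Z) :
    rot (⇑δ) I j z ∈ Submodule.span F (InderSet (⇑δ)) := by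
  have he : ∀ (f g : Z) (k l : Fin 4),
      Dgen (⇑δ) 1 (fw f k) (fw g l) ∈ Submodule.span F (InderSet (⇑δ)) := fun f g k l =>
    Submodule.subset_span ⟨fw f k, fw g l, false, false, rfl, rfl, rfl⟩
  have ho : ∀ (f g : Z) (k : Fin 4),
      Dgen (⇑δ) 1 (fw f k) (fx g) ∈ Submodule.span F (InderSet (⇑δ)) := fun f g k =>
    Submodule.subset_span ⟨fw f k, fx g, false, true, rfl, rfl, rfl⟩
  have hz : rot (⇑δ) I j z = rot (⇑δ) I j (z.1, 0) + rot (⇑δ) I j (0, z.2) := by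
    rw [← rot_add, Prod.fst_add_snd]
  obtain ⟨f, g⟩ := z
  rw [hz]
  refine Submodule.add_mem _ ?_ ?_
  · fin_cases j
    · convert he 1 (I * f) 2 3 using 1
      funext u
      apply J_ext <;> simp [rot, Dgen, hδ]
    · convert he 1 (-(I * f)) 1 3 using 1
      funext u
      apply J_ext <;> simp [rot, Dgen, hδ]
    · convert he 1 (-f) 1 2 using 1
      funext u
      apply J_ext <;> simp [rot, Dgen]
  · fin_cases j
    · convert ho 1 (-g) 1 using 1
      funext u
      apply J_ext <;> simp [rot, Dgen, fx] <;> grind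
    · convert ho 1 (-g) 2 using 1
      funext u
      apply J_ext <;> simp [rot, Dgen, fx] <;> grind
    · convert ho 1 (I * g) 3 using 1
      funext u
      apply J_ext <;> simp [rot, Dgen, fx, hδ] <;> grind

include hδ in
theorem map_psi_le_span_inderSet :
    (Submodule.prod ⊤ (Submodule.span F (InderKSet (⇑δ)))).map (psi δ I) ≤
      Submodule.span F (InderSet (⇑δ)) := by
  rintro _ ⟨⟨ζ, e⟩, ⟨-, he⟩, rfl⟩
  refine Submodule.add_mem _ (Submodule.sum_mem _ fun j _ => rot_mem_span_inderSet δ hδ j _) ?_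
  change e ∈ Submodule.span F (InderKSet (⇑δ)) at he
  change kext I e ∈ _
  induction he using Submodule.span_induction with
  | mem e he =>
    obtain ⟨u, v, p, q, hu, hv, rfl⟩ := he
    exact Submodule.subset_span (kext_Dk_mem_inderSet δ hδ hu hv)
  | zero => simp
  | add e e' _ _ he he' =>
    rw [kext_add]
    exact Submodule.add_mem _ he he'
  | smul t e _ he =>
    rw [kext_smul]
    exact Submodule.smul_mem _ t he

include hI hδ

theorem span_inderSet_le (hspan : Submodule.span F {z : Z | ∃ f g : Z, z = f * δ g} = ⊤) :
    Submodule.span F (InderSet (⇑δ)) ≤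
      (Submodule.prod ⊤ (Submodule.span F (InderKSet (⇑δ)))).map (psi δ I) := by
  rw [Submodule.span_le]
  rintro _ ⟨⟨a, b⟩, ⟨c, d⟩, p, q, hp, hq, rfl⟩
  have hswap : ∀ u v : J Z, Dgen (⇑δ) 1 u v = -Dgen (⇑δ) 1 v u := fun u v => by
    funext w
    simp [Dgen]
  have heo : ∀ a d : Fin 4 → Z, Dgen (⇑δ) 1 (a, 0) (0, d) ∈
      (Submodule.prod ⊤ (Submodule.span F (InderKSet (⇑δ)))).map (psi δ I) := fun a d => by
    rw [Dgen_even_odd δ hI hδ]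
    exact Submodule.mem_map_of_mem ⟨trivial, keta_mem_span_inderKSet hspan _⟩
  cases p <;> cases q <;> simp only [IsHom, if_true, Bool.false_eq_true, if_false] at hp hq <;>
    subst hp hq
  · simp only [sgn, Bool.and_self, Bool.false_eq_true, if_false]
    rw [Dgen_even_even δ hI hδ]
    exact Submodule.mem_map_of_mem ⟨trivial, Submodule.zero_mem _⟩
  · exact heo a d
  · change Dgen (⇑δ) 1 _ _ ∈ _
    rw [hswap]
    exact Submodule.neg_mem _ (heo c b)
  · simp only [sgn, Bool.and_self, if_true]
    rw [Dgen_odd_odd δ hI hδ]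
    exact Submodule.mem_map_of_mem ⟨trivial, Submodule.subset_span
      ⟨(0, b 0), (0, d 0), true, true, rfl, rfl, rfl⟩⟩

theorem psi_image_span_inderKSet
    (hspan : Submodule.span F {z : Z | ∃ f g : Z, z = f * δ g} = ⊤) :
    psi δ I '' {p | p.2 ∈ (Submodule.span F (InderKSet (⇑δ)) : Set (Z × Z → Z × Z))} =
      (Submodule.span F (InderSet (⇑δ)) : Set (J Z → J Z)) := by
  rw [← le_antisymm (map_psi_le_span_inderSet δ hδ) (span_inderSet_le δ hI hδ hspan),
    Submodule.map_coe]
  congr 1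
  ext p
  simp

end Inner

end CKJ

open CKJ
theorem stmt19 {F : Type*} [Field F] (h2 : (2 : F) ≠ 0) {Z : Type*} [CommRing Z] [Algebra F Z]
    (δ : Derivation F Z Z)
    (hspan : Submodule.span F {z : Z | ∃ f g : Z, z = f * δ g} = ⊤)
    (i : F) (hi : i ^ 2 = -1) :
    -- Ψ : (𝔰𝔬₃ ⊗ K) ⊕ D̄er(K) → Der(J); an element of the source is a pair
    -- `(ζ, e)` representing `E₁⊗ζ(0) + E₂⊗ζ(1) + E₃⊗ζ(2) + e`
    ∃ Ψ : (Fin 3 → Z × Z) × ((Z × Z) → Z × Z) → (J Z → J Z),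
      -- Ψ(Eⱼ ⊗ z) = ιⱼ(z)
      (∀ (j : Fin 3) (z : Z × Z), Ψ (Pi.single j z, 0) = iot F (⇑δ) i j z) ∧
      -- Ψ(d) = (Φ*)⁻¹(d) for d ∈ D̄er(K), i.e. Φ*(Ψ(0,e)) = e
      (∀ e ∈ DerbarK F (⇑δ), ∀ z : Z × Z,
        sbr F (Ψ (0, e)) (Phi F (⇑δ) i z) = Phi F (⇑δ) i (e z)) ∧
      -- Ψ is F-linear on the source
      (∀ p q : (Fin 3 → Z × Z) × ((Z × Z) → Z × Z),
        p.2 ∈ DerbarK F (⇑δ) → q.2 ∈ DerbarK F (⇑δ) → Ψ (p + q) = Ψ p + Ψ q) ∧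
      (∀ (c : F) (p : (Fin 3 → Z × Z) × ((Z × Z) → Z × Z)),
        p.2 ∈ DerbarK F (⇑δ) → Ψ (c • p) = c • Ψ p) ∧
      -- Ψ is a bijection of 𝒯(K, D̄er(K)) onto Der(J)
      Set.BijOn Ψ {p : (Fin 3 → Z × Z) × ((Z × Z) → Z × Z) | p.2 ∈ DerbarK F (⇑δ)}
        (DerJSet F (⇑δ)) ∧
      -- Ψ intertwines the Tits bracket with the supercommutator:
      -- [Eⱼ⊗z, Eⱼ⊗z'] = ½tr(Eⱼ²)·D(z,z') = -D(z,z') (z, z' homogeneous)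
      (∀ (j : Fin 3) (z z' : Z × Z) (p q : Bool), KHom p z → KHom q z' →
        sbr F (Ψ (Pi.single j z, 0)) (Ψ (Pi.single j z', 0))
          = Ψ (0, -Dk (⇑δ) (sgn p q) z z')) ∧
      -- [Eⱼ⊗z, Eⱼ₊₁⊗z'] = Eⱼ₊₂ ⊗ zz'
      (∀ (j : Fin 3) (z z' : Z × Z),
        sbr F (Ψ (Pi.single j z, 0)) (Ψ (Pi.single (j + 1) z', 0))
          = Ψ (Pi.single (j + 2) (kmul (⇑δ) z z'), 0)) ∧
      -- [Eⱼ⊗z, Eⱼ₊₂⊗z'] = -Eⱼ₊₁ ⊗ zz'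
      (∀ (j : Fin 3) (z z' : Z × Z),
        sbr F (Ψ (Pi.single j z, 0)) (Ψ (Pi.single (j + 2) z', 0))
          = Ψ (Pi.single (j + 1) (-kmul (⇑δ) z z'), 0)) ∧
      -- [d, Eⱼ⊗z] = Eⱼ ⊗ d(z) for d ∈ D̄er(K)
      (∀ e ∈ DerbarK F (⇑δ), ∀ (j : Fin 3) (z : Z × Z),
        sbr F (Ψ (0, e)) (Ψ (Pi.single j z, 0)) = Ψ (Pi.single j (e z), 0)) ∧
      -- D̄er(K) is a subalgebra
      (∀ e ∈ DerbarK F (⇑δ), ∀ e' ∈ DerbarK F (⇑δ),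
        sbr F (Ψ (0, e)) (Ψ (0, e')) = Ψ (0, ksbr F e e')) ∧
      -- Ψ restricts to an isomorphism of 𝒯(K) = (𝔰𝔬₃ ⊗ K) ⊕ Inder(K) onto Inder(J)
      (Ψ '' {p : (Fin 3 → Z × Z) × ((Z × Z) → Z × Z) |
            p.2 ∈ (Submodule.span F (InderKSet (⇑δ)) : Set ((Z × Z) → Z × Z))}
          = (Submodule.span F (InderSet (⇑δ)) : Set (J Z → J Z))) := by
  have hI : algebraMap F Z i * algebraMap F Z i = -1 := by
    rw [← map_mul, ← pow_two, hi, map_neg, map_one]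
  have hδ : δ (algebraMap F Z i) = 0 := δ.map_algebraMap i
  have hkr : ∀ e ∈ DerbarK F (⇑δ), ∀ (j : Fin 3) (z : Z × Z),
      sbr F (kext (algebraMap F Z i) e) (rot (⇑δ) (algebraMap F Z i) j z) =
        rot (⇑δ) (algebraMap F Z i) j (e z) := by
    intro e he j z
    obtain ⟨μ, a, c, h, rfl⟩ := (mem_DerbarK_iff δ e).1 he
    exact sbr_kext_rot h2 h hI hδ (μ.map_algebraMap i) j z
  refine ⟨psi δ (algebraMap F Z i), ?_, ?_, ?_, ?_,
    ⟨fun p hp => psi_mem_DerJSet hδ hp, psi_injOn hI, psi_surjOn h2 hspan hI hδ⟩,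
    ?_, ?_, ?_, ?_, ?_, psi_image_span_inderKSet δ hI hδ hspan⟩
  · intro j z
    rw [psi_single, iot_eq_rot δ hi]
  · intro e he z
    have hPhi : ∀ z, Phi F (⇑δ) i z = rot (⇑δ) (algebraMap F Z i) 2 z := iot_eq_rot δ hi 2
    rw [psi_zero_left, hPhi, hPhi]
    exact hkr e he 2 z
  · intro p q _ _
    exact map_add _ p q
  · intro c p _
    exact map_smul _ c p
  · intro j z z' p q hz hz'
    rw [psi_single, psi_single, psi_zero_left]
    exact sbr_rot_self h2 δ hI hδ j z z' p q hz hz'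
  · intro j z z'
    rw [psi_single, psi_single, psi_single]
    exact sbr_rot_succ h2 δ hI hδ j z z'
  · intro j z z'
    rw [psi_single, psi_single, psi_single]
    exact sbr_rot_pred h2 δ hI hδ j z z'
  · intro e he j z
    rw [psi_zero_left, psi_single, psi_single]
    exact hkr e he j z
  · intro e he e' he'
    obtain ⟨μ, a, c, -, rfl⟩ := (mem_DerbarK_iff δ e).1 he
    obtain ⟨μ', a', c', -, rfl⟩ := (mem_DerbarK_iff δ e').1 he'
    rw [psi_zero_left, psi_zero_left, psi_zero_left]
    exact sbr_kext_kext h2 (μ.map_algebraMap i) (μ'.map_algebraMap i) a c a' c'
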